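/- arXiv:1611.01491 — 7 statements merged into one kernel-verified Lean document; each statement's English description precedes it below -/
import Mathlib

section
/- If a continuous piecewise linear function f : ℝ → ℝ with p pieces is represented by a ReLU DNN with one hidden layer (depth 2), then the width of the hidden layer (the size of the DNN) is at least p − 1. -/
open scoped BigOperators

noncomputable section

/-- Coordinatewise ReLU activation. -/
def reluVec {n : ℕ} (x : Fin n → ℝ) : Fin n → ℝ := fun i => max (x i) 0

/-- `T` is an affine transformation. -/
def IsAffineT {n m : ℕ} (T : (Fin n → ℝ) → (Fin m → ℝ)) : Prop :=
  ∃ (A : Matrix (Fin m) (Fin n) ℝ) (b : Fin m → ℝ), ∀ x, T x = A.mulVec x + b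

/-- `T` is a linear transformation. -/
def IsLinearT {n m : ℕ} (T : (Fin n → ℝ) → (Fin m → ℝ)) : Prop :=
  ∃ A : Matrix (Fin m) (Fin n) ℝ, ∀ x, T x = A.mulVec x

/-- `RepresentsWith ws f` : the function `f : ℝ^n → ℝ^m` is computed by a ReLU DNN whose
hidden layers have widths given by the list `ws` (so the DNN has `ws.length` hidden layers,
depth `ws.length + 1` and size `ws.sum`). -/
def RepresentsWithAux : List ℕ → (n m : ℕ) → ((Fin n → ℝ) → (Fin m → ℝ)) → Prop
  | [], _, _, f => IsLinearT f
  | w :: ws, n, m, f =>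
      ∃ (T : (Fin n → ℝ) → (Fin w → ℝ)) (g : (Fin w → ℝ) → (Fin m → ℝ)),
        IsAffineT T ∧ RepresentsWithAux ws w m g ∧ ∀ x, f x = g (reluVec (T x))

/-- See `RepresentsWithAux`. -/
def RepresentsWith (ws : List ℕ) {n m : ℕ} (f : (Fin n → ℝ) → (Fin m → ℝ)) : Prop :=
  RepresentsWithAux ws n m f

/-- Representability for real-valued functions on `ℝ^n`. -/
def RepresentsR (ws : List ℕ) {n : ℕ} (f : (Fin n → ℝ) → ℝ) : Prop :=
  RepresentsWith ws (fun x => fun _ : Fin 1 => f x)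

/-- Representability for `ℝ → ℝ` functions. -/
def Represents1D (ws : List ℕ) (f : ℝ → ℝ) : Prop :=
  RepresentsWith ws (fun x : Fin 1 → ℝ => fun _ : Fin 1 => f (x 0))

/-- `f` agrees with an affine function on the set `S`. -/
def AffineOnSet {n : ℕ} (f : (Fin n → ℝ) → ℝ) (S : Set (Fin n → ℝ)) : Prop :=
  ∃ (c : Fin n → ℝ) (d : ℝ), ∀ x ∈ S, f x = (∑ j, c j * x j) + d

/-- A polyhedron: the intersection of finitely many halfspaces. -/
def IsPolyhedron {n : ℕ} (P : Set (Fin n → ℝ)) : Prop :=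
  ∃ (m : ℕ) (A : Fin m → Fin n → ℝ) (b : Fin m → ℝ),
    P = {x | ∀ i, (∑ j, A i j * x j) ≤ b i}

/-- Continuous piecewise linear function on `ℝ^n`: finitely many polyhedra covering `ℝ^n`,
with `f` affine on each. -/
def IsPWL {n : ℕ} (f : (Fin n → ℝ) → ℝ) : Prop :=
  ∃ (N : ℕ) (P : Fin N → Set (Fin n → ℝ)),
    (∀ i, IsPolyhedron (P i)) ∧ (⋃ i, P i) = Set.univ ∧ ∀ i, AffineOnSet f (P i)

/-- `f : ℝ → ℝ` is piecewise linear with breakpoints `b 0 < b 1 < ⋯ < b (q-1)`, being affine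
with slope `sl i` and intercept `ic i` on the `i`-th of the `q+1` closed pieces into which the
breakpoints partition `ℝ`. -/
def RealizesPieces (q : ℕ) (b : Fin q → ℝ) (sl ic : Fin (q+1) → ℝ) (f : ℝ → ℝ) : Prop :=
  StrictMono b ∧
  ∀ (i : Fin (q+1)) (x : ℝ),
    (∀ j : Fin q, (j : ℕ) < (i : ℕ) → b j ≤ x) →
    (∀ j : Fin q, (i : ℕ) ≤ (j : ℕ) → x ≤ b j) →
    f x = sl i * x + ic i

/-- `f : ℝ → ℝ` is continuous piecewise linear with exactly `p` pieces: `ℝ` is partitioned into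
`p` intervals on each of which `f` is affine, and consecutive pieces have different slopes. -/
def PWLPiecesExact (p : ℕ) (f : ℝ → ℝ) : Prop :=
  ∃ q : ℕ, p = q + 1 ∧ ∃ (b : Fin q → ℝ) (sl ic : Fin (q+1) → ℝ),
    RealizesPieces q b sl ic f ∧ ∀ i : Fin q, sl i.castSucc ≠ sl i.succ

/-- `f : ℝ → ℝ` is continuous piecewise linear with at most `p` pieces. -/
def PWLPiecesAtMost (p : ℕ) (f : ℝ → ℝ) : Prop :=
  ∃ q : ℕ, q + 1 ≤ p ∧ ∃ (b : Fin q → ℝ) (sl ic : Fin (q+1) → ℝ),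
    RealizesPieces q b sl ic f

/-- Membership in the simplex `Δ^p_M = {x : 0 < x 0 < x 1 < ⋯ < x (p-1) < M}`. -/
def InSimplex (M : ℝ) {p : ℕ} (a : Fin p → ℝ) : Prop :=
  StrictMono a ∧ (∀ i, 0 < a i) ∧ ∀ i, a i < M

/-- The knots `0, a 0, a 1, …, a (p-1), M` of the function `h_a`. -/
def knot (M : ℝ) {p : ℕ} (a : Fin p → ℝ) (i : Fin (p+2)) : ℝ :=
  if _h0 : (i : ℕ) = 0 then 0
  else if _h1 : (i : ℕ) = p + 1 then M
  else a ⟨(i : ℕ) - 1, by have := i.isLt; omega⟩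

/-- The prescribed value of `h_a` at the `i`-th knot: it alternates `0, M, 0, M, …`. -/
def knotVal (M : ℝ) (p : ℕ) (i : Fin (p+2)) : ℝ :=
  if (i : ℕ) % 2 = 1 then M else 0

/-- `h` is the function `h_a` associated with `a ∈ Δ^p_M`: it vanishes on `(-∞,0]`, is affine on
each interval between consecutive knots with the prescribed alternating values `0,M,0,M,…` at
the knots, and for `x ≥ M` it linearly continues the piece on `[a (p-1), M]`. -/
def IsHa (M : ℝ) {p : ℕ} (a : Fin p → ℝ) (h : ℝ → ℝ) : Prop :=
  (∀ x : ℝ, x ≤ 0 → h x = 0) ∧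
  (∀ i : Fin (p+1), ∀ t ∈ Set.Icc (0:ℝ) 1,
      h ((1 - t) * knot M a i.castSucc + t * knot M a i.succ)
        = (1 - t) * knotVal M p i.castSucc + t * knotVal M p i.succ) ∧
  (∀ x : ℝ, M ≤ x →
      h x = knotVal M p (Fin.last (p+1))
        + (x - M) * ((knotVal M p (Fin.last (p+1)) - knotVal M p ⟨p, by omega⟩)
            / (M - knot M a ⟨p, by omega⟩)))

/-- The composition `h (k-1) ∘ ⋯ ∘ h 1 ∘ h 0` of a finite family of `ℝ → ℝ` functions. -/
def compFold {k : ℕ} (h : Fin k → ℝ → ℝ) : ℝ → ℝ :=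
  fun x => (List.ofFn h).foldl (fun y g => g y) x

/-- `[0,M]` is partitioned into exactly `N` subintervals, on each of which `f` is affine
with minimum value `0` and maximum value `M`. -/
def PartitionAffineMinMax (f : ℝ → ℝ) (M : ℝ) (N : ℕ) : Prop :=
  ∃ c : Fin (N+1) → ℝ, StrictMono c ∧ c 0 = 0 ∧ c (Fin.last N) = M ∧
    ∀ i : Fin N,
      (∃ s d : ℝ, ∀ x ∈ Set.Icc (c i.castSucc) (c i.succ), f x = s * x + d) ∧
      (∀ x ∈ Set.Icc (c i.castSucc) (c i.succ), 0 ≤ f x ∧ f x ≤ M) ∧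
      (∃ x ∈ Set.Icc (c i.castSucc) (c i.succ), f x = 0) ∧
      (∃ x ∈ Set.Icc (c i.castSucc) (c i.succ), f x = M)

/-- `[0,M]` is partitioned into exactly `N` maximal subintervals of affinity of `f`:
`f` is affine on each subinterval and consecutive subintervals carry different slopes. -/
def PartitionAffineExact (f : ℝ → ℝ) (M : ℝ) (N : ℕ) : Prop :=
  ∃ (c : Fin (N+1) → ℝ) (s d : Fin N → ℝ), StrictMono c ∧ c 0 = 0 ∧ c (Fin.last N) = M ∧
    (∀ i : Fin N, ∀ x ∈ Set.Icc (c i.castSucc) (c i.succ), f x = s i * x + d i) ∧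
    ∀ i j : Fin N, (j : ℕ) = (i : ℕ) + 1 → s i ≠ s j

/-- The zonotope `Z(b 0, …, b (m-1)) = {λ₀ b⁰ + ⋯ + λ_{m-1} b^{m-1} : |λᵢ| ≤ 1}`. -/
def Zono {n m : ℕ} (b : Fin m → Fin n → ℝ) : Set (Fin n → ℝ) :=
  {x | ∃ lam : Fin m → ℝ, (∀ i, |lam i| ≤ 1) ∧ x = ∑ i, lam i • b i}

/-- The set of maximal connected subsets of `ℝ^n` on which `f` is affine (the "pieces"). -/
def MaxAffinePieces {n : ℕ} (f : (Fin n → ℝ) → ℝ) : Set (Set (Fin n → ℝ)) :=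
  {S | IsConnected S ∧ AffineOnSet f S ∧
    ∀ S', IsConnected S' → AffineOnSet f S' → S ⊆ S' → S' = S}

end

/-- A function computed with one hidden layer is a linear combination of ReLU units. -/
lemma Represents1D.exists_sum {w : ℕ} {f : ℝ → ℝ} (h : Represents1D [w] f) :
    ∃ a d c : Fin w → ℝ, ∀ x, f x = ∑ i, c i * max (a i * x + d i) 0 := by
  obtain ⟨T, g, ⟨A, d, hT⟩, ⟨C, hg⟩, hf⟩ := h
  refine ⟨fun i => A i 0, d, C 0, fun x => ?_⟩
  have hx := congrFun (hf fun _ => x) 0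
  simpa [hg, hT, reluVec, Matrix.mulVec, dotProduct] using hx

/-- A ReLU unit is differentiable away from its kink. -/
lemma differentiableAt_max_affine_zero {a d t : ℝ} (h : a ≠ 0 → a * t + d ≠ 0) :
    DifferentiableAt ℝ (fun x => max (a * x + d) 0) t := by
  by_cases ha : a = 0
  · simp [ha]
  have hcont : ContinuousAt (fun x : ℝ => a * x + d) t := by fun_prop
  rcases lt_or_gt_of_ne (h ha) with hneg | hpos
  · refine (differentiableAt_const (0 : ℝ)).congr_of_eventuallyEq ?_
    filter_upwards [hcont.eventually_lt_const hneg] with x hx using max_eq_right hx.le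
  · have hd : DifferentiableAt ℝ (fun x : ℝ => a * x + d) t := by fun_prop
    refine hd.congr_of_eventuallyEq ?_
    filter_upwards [hcont.eventually_const_lt hpos] with x hx using max_eq_left hx.le

/-- If the slopes on both sides of a breakpoint differ, the function is not differentiable there. -/
lemma RealizesPieces.not_differentiableAt {q : ℕ} {b : Fin q → ℝ} {sl ic : Fin (q + 1) → ℝ}
    {f : ℝ → ℝ} (h : RealizesPieces q b sl ic f) {k : Fin q} (hk : sl k.castSucc ≠ sl k.succ) :
    ¬ DifferentiableAt ℝ f (b k) := by
  obtain ⟨hb, hf⟩ := h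
  intro hd
  have hline (s c : ℝ) (S : Set ℝ) : HasDerivWithinAt (fun x => s * x + c) s S (b k) := by
    simpa using (((hasDerivAt_id (b k)).const_mul s).add_const c).hasDerivWithinAt (s := S)
  have hpred : ∀ᶠ x in nhds (b k), ∀ j : Fin q, j < k → b j ≤ x :=
    Filter.eventually_all.2 fun j => Filter.eventually_imp_distrib_left.2 fun hj =>
      (lt_mem_nhds (hb hj)).mono fun x hx => hx.le
  have hsucc : ∀ᶠ x in nhds (b k), ∀ j : Fin q, k < j → x ≤ b j :=
    Filter.eventually_all.2 fun j => Filter.eventually_imp_distrib_left.2 fun hj =>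
      (gt_mem_nhds (hb hj)).mono fun x hx => hx.le
  have hleft : ∀ᶠ x in nhds (b k), x ≤ b k → f x = sl k.castSucc * x + ic k.castSucc := by
    filter_upwards [hpred] with x hx hxk
    exact hf _ _ (fun j hj => hx j hj) fun j hj => hxk.trans (hb.monotone hj)
  have hright : ∀ᶠ x in nhds (b k), b k ≤ x → f x = sl k.succ * x + ic k.succ := by
    filter_upwards [hsucc] with x hx hxk
    refine hf _ _ (fun j hj => (hb.monotone ?_).trans hxk) fun j hj => hx j ?_
    · exact Nat.lt_succ_iff.1 hj
    · exact Nat.lt_of_succ_le hj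
  have hl : HasDerivWithinAt f (sl k.castSucc) (Set.Iic (b k)) (b k) :=
    (hline _ (ic k.castSucc) _).congr_of_eventuallyEq
      (eventually_nhdsWithin_iff.2 hleft) (hleft.self_of_nhds le_rfl)
  have hr : HasDerivWithinAt f (sl k.succ) (Set.Ici (b k)) (b k) :=
    (hline _ (ic k.succ) _).congr_of_eventuallyEq
      (eventually_nhdsWithin_iff.2 hright) (hright.self_of_nhds le_rfl)
  exact hk <|
    ((uniqueDiffWithinAt_Iic _).eq_deriv _ hl hd.hasDerivAt.hasDerivWithinAt).trans
      ((uniqueDiffWithinAt_Ici _).eq_deriv _ hr hd.hasDerivAt.hasDerivWithinAt).symm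

/-- If a continuous piecewise linear `f : ℝ → ℝ` with `p` pieces is represented by
a ReLU DNN with one hidden layer of width `w`, then `w ≥ p - 1`. -/
theorem stmt3 (p w : ℕ) (f : ℝ → ℝ) (hf : PWLPiecesExact p f)
    (hrep : Represents1D [w] f) :
    p - 1 ≤ w := by
  obtain ⟨q, rfl, b, sl, ic, hpieces, hne⟩ := hf
  obtain ⟨a, d, c, hsum⟩ := hrep.exists_sum
  have hkink (k : Fin q) : ∃ i, a i ≠ 0 ∧ a i * b k + d i = 0 := by
    by_contra! hno
    refine hpieces.not_differentiableAt (hne k) ?_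
    rw [funext hsum]
    exact DifferentiableAt.fun_sum fun i _ =>
      (differentiableAt_max_affine_zero (hno i)).const_mul (c i)
  choose u hu hzero using hkink
  have hinj : Function.Injective u := by
    intro k l hkl
    refine hpieces.1.injective (mul_left_cancel₀ (hu k) ?_)
    have hk := hzero k
    have hl := hzero l
    rw [← hkl] at hl
    linarith
  simpa using Fintype.card_le_of_injective u hinj
end

section
/- For any M > 0, p ∈ ℕ, k ∈ ℕ, and a¹,…,a^k ∈ Δ^p_M, the composition H_{a¹,…,a^k} = h_{a^k} ∘ ⋯ ∘ h_{a¹} is a continuous piecewise linear function with at most (p+1)^k + 2 pieces; moreover the interval [0,M] is partitioned into exactly (p+1)^k subintervals on each of which H_{a¹,…,a^k} is affine, and on each such subinterval the function attains minimum value 0 and maximum value M. -/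
open scoped BigOperators

/-- On `[u, v]` the function `f` is affine and runs from `0` to `M` or from `M` to `0`. -/
def IsMonotoneTooth (M : ℝ) (f : ℝ → ℝ) (u v : ℝ) : Prop :=
  u < v ∧ ∃ s d : ℝ, (∀ x ∈ Set.Icc u v, f x = s * x + d) ∧
    ((s * u + d = 0 ∧ s * v + d = M) ∨ (s * u + d = M ∧ s * v + d = 0))

/-- `[u, v]` is a concatenation of `n` intervals, each a monotone tooth of `f`. -/
inductive IsZigzag (M : ℝ) (f : ℝ → ℝ) : ℝ → ℝ → ℕ → Prop
  | nil (u : ℝ) : IsZigzag M f u u 0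
  | cons {u v w : ℝ} {n : ℕ} (hd : IsMonotoneTooth M f u v) (tl : IsZigzag M f v w n) :
      IsZigzag M f u w (n + 1)

theorem IsMonotoneTooth.congr {M : ℝ} {f g : ℝ → ℝ} {u v : ℝ} (hf : IsMonotoneTooth M f u v)
    (hfg : Set.EqOn f g (Set.Icc u v)) : IsMonotoneTooth M g u v := by
  obtain ⟨huv, s, d, hs, hend⟩ := hf
  exact ⟨huv, s, d, fun x hx => (hfg hx).symm.trans (hs x hx), hend⟩

theorem IsMonotoneTooth.comp_affine_of_pos {M s d u v : ℝ} {g : ℝ → ℝ}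
    (hg : IsMonotoneTooth M g u v) (hs : 0 < s) :
    IsMonotoneTooth M (fun x => g (s * x + d)) ((u - d) / s) ((v - d) / s) := by
  obtain ⟨huv, s', d', haff, hend⟩ := hg
  refine ⟨by gcongr, s' * s, s' * d + d', fun x hx => ?_, ?_⟩
  · have h1 := (div_le_iff₀ hs).1 hx.1
    have h2 := (le_div_iff₀ hs).1 hx.2
    have := haff (s * x + d) ⟨by linarith, by linarith⟩
    linear_combination this
  · have key : ∀ y, s' * s * ((y - d) / s) + (s' * d + d') = s' * y + d' := fun y => by
      field_simp
      ring
    simpa only [key] using hend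

theorem IsMonotoneTooth.comp_affine_of_neg {M s d u v : ℝ} {g : ℝ → ℝ}
    (hg : IsMonotoneTooth M g u v) (hs : s < 0) :
    IsMonotoneTooth M (fun x => g (s * x + d)) ((v - d) / s) ((u - d) / s) := by
  obtain ⟨huv, s', d', haff, hend⟩ := hg
  refine ⟨div_lt_div_of_neg_of_lt hs (by linarith), s' * s, s' * d + d', fun x hx => ?_, ?_⟩
  · have h1 := (div_le_iff_of_neg hs).1 hx.1
    have h2 := (le_div_iff_of_neg hs).1 hx.2
    have := haff (s * x + d) ⟨by linarith, by linarith⟩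
    linear_combination this
  · have hs0 := hs.ne
    have key : ∀ y, s' * s * ((y - d) / s) + (s' * d + d') = s' * y + d' := fun y => by
      field_simp
      ring
    simp only [key]
    tauto

namespace IsZigzag

variable {M : ℝ} {f g : ℝ → ℝ} {u v w : ℝ} {m n : ℕ}

theorem le (hf : IsZigzag M f u v n) : u ≤ v := by
  induction hf with
  | nil => exact le_rfl
  | cons hd _ ih => exact hd.1.le.trans ih

theorem append (hf : IsZigzag M f u v m) (hf' : IsZigzag M f v w n) :
    IsZigzag M f u w (m + n) := by
  induction hf with
  | nil => simpa using hf'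
  | cons hd _ ih =>
    rw [Nat.add_right_comm]
    exact cons hd (ih hf')

theorem snoc (hf : IsZigzag M f u v n) (hl : IsMonotoneTooth M f v w) :
    IsZigzag M f u w (n + 1) :=
  hf.append (cons hl (nil w))

theorem congr (hf : IsZigzag M f u v n) (hfg : Set.EqOn f g (Set.Icc u v)) :
    IsZigzag M g u v n := by
  induction hf with
  | nil => exact nil _
  | cons hd tl ih =>
    exact cons (hd.congr (hfg.mono (Set.Icc_subset_Icc_right tl.le)))
      (ih (hfg.mono (Set.Icc_subset_Icc_left hd.1.le)))

theorem comp_affine_of_pos {s d : ℝ} (hg : IsZigzag M g u v n) (hs : 0 < s) :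
    IsZigzag M (fun x => g (s * x + d)) ((u - d) / s) ((v - d) / s) n := by
  induction hg with
  | nil => exact nil _
  | cons hd _ ih => exact cons (hd.comp_affine_of_pos hs) ih

theorem comp_affine_of_neg {s d : ℝ} (hg : IsZigzag M g u v n) (hs : s < 0) :
    IsZigzag M (fun x => g (s * x + d)) ((v - d) / s) ((u - d) / s) n := by
  induction hg with
  | nil => exact nil _
  | cons hd _ ih => exact ih.snoc (hd.comp_affine_of_neg hs)

theorem comp_tooth (hM : 0 < M) (hg : IsZigzag M g 0 M n) (hf : IsMonotoneTooth M f u v) :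
    IsZigzag M (fun x => g (f x)) u v n := by
  obtain ⟨huv, s, d, haff, ⟨hu, hv⟩ | ⟨hu, hv⟩⟩ := hf
  · have hs : 0 < s := by
      by_contra! hs
      nlinarith
    have hz := hg.comp_affine_of_pos (d := d) hs
    rw [show (0 - d) / s = u by field_simp; linarith,
      show (M - d) / s = v by field_simp; linarith] at hz
    exact hz.congr fun x hx => by simp only [haff x hx]
  · have hs : s < 0 := by
      by_contra! hs
      nlinarith
    have hs0 := hs.ne
    have hz := hg.comp_affine_of_neg (d := d) hs
    rw [show (0 - d) / s = v by field_simp; linarith,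
      show (M - d) / s = u by field_simp; linarith] at hz
    exact hz.congr fun x hx => by simp only [haff x hx]

theorem comp (hM : 0 < M) (hg : IsZigzag M g 0 M n) (hf : IsZigzag M f u v m) :
    IsZigzag M (fun x => g (f x)) u v (m * n) := by
  induction hf with
  | nil u => simpa using nil u
  | cons hd _ ih =>
    rw [Nat.succ_mul, Nat.add_comm]
    exact (hg.comp_tooth hM hd).append ih

theorem exists_nodes (hf : IsZigzag M f u v n) :
    ∃ c : ℕ → ℝ, c 0 = u ∧ c n = v ∧ ∀ i < n, IsMonotoneTooth M f (c i) (c (i + 1)) := by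
  induction hf with
  | nil u => exact ⟨fun _ => u, rfl, rfl, by simp⟩
  | @cons u _ _ _ hd _ ih =>
    obtain ⟨c, h0, hn, hc⟩ := ih
    refine ⟨fun i => Nat.casesOn i u c, rfl, hn, ?_⟩
    rintro (_ | i) hi
    · simpa [h0] using hd
    · exact hc i (by omega)

end IsZigzag

/-- `f` zigzags `N` times between `0` and `M` on `[0, M]`, and is affine on each of the two
unbounded rays, which it maps outside `(0, M)`. -/
structure IsSawtooth (M : ℝ) (N : ℕ) (f : ℝ → ℝ) : Prop where
  zigzag : IsZigzag M f 0 M N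
  affine_left : ∃ s d : ℝ, ∀ x ≤ 0, f x = s * x + d
  left_nonpos : ∀ x ≤ 0, f x ≤ 0
  affine_right : ∃ s d : ℝ, ∀ x, M ≤ x → f x = s * x + d
  right_outside : (∀ x, M ≤ x → f x ≤ 0) ∨ ∀ x, M ≤ x → M ≤ f x

namespace IsSawtooth

variable {M : ℝ} {N K : ℕ} {f g : ℝ → ℝ}

theorem id (hM : 0 < M) : IsSawtooth M 1 (fun x => x) where
  zigzag := .cons ⟨hM, 1, 0, by simp, by simp⟩ (.nil M)
  affine_left := ⟨1, 0, by simp⟩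
  left_nonpos := by simp
  affine_right := ⟨1, 0, by simp⟩
  right_outside := by simp

theorem comp (hM : 0 < M) (hg : IsSawtooth M K g) (hg0 : ∀ x ≤ 0, g x = 0)
    (hf : IsSawtooth M N f) : IsSawtooth M (N * K) (fun x => g (f x)) where
  zigzag := hg.zigzag.comp hM hf.zigzag
  affine_left := ⟨0, 0, fun x hx => by simp [hg0 _ (hf.left_nonpos x hx)]⟩
  left_nonpos x hx := (hg0 _ (hf.left_nonpos x hx)).le
  affine_right := by
    obtain ⟨s, d, hs⟩ := hf.affine_right
    obtain ⟨s', d', hs'⟩ := hg.affine_right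
    rcases hf.right_outside with h | h
    · exact ⟨0, 0, fun x hx => by simp [hg0 _ (h x hx)]⟩
    · refine ⟨s' * s, s' * d + d', fun x hx => ?_⟩
      rw [hs' _ (h x hx), hs x hx]
      ring
  right_outside := by
    rcases hf.right_outside with h | h
    · exact .inl fun x hx => (hg0 _ (h x hx)).le
    · exact hg.right_outside.imp (fun h' x hx => h' _ (h x hx)) fun h' x hx => h' _ (h x hx)

theorem exists_partition (hf : IsSawtooth M N f) :
    ∃ c : Fin (N + 1) → ℝ, StrictMono c ∧ c 0 = 0 ∧ c (Fin.last N) = M ∧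
      ∀ i : Fin N, IsMonotoneTooth M f (c i.castSucc) (c i.succ) := by
  obtain ⟨c, h0, hN, hc⟩ := hf.zigzag.exists_nodes
  exact ⟨fun i => c i, Fin.strictMono_iff_lt_succ.2 fun i => (hc i i.isLt).1, h0, hN,
    fun i => hc i i.isLt⟩

theorem partitionAffineMinMax (hM : 0 < M) (hf : IsSawtooth M N f) :
    PartitionAffineMinMax f M N := by
  obtain ⟨c, hmono, h0, hN, hc⟩ := hf.exists_partition
  refine ⟨c, hmono, h0, hN, fun i => ?_⟩
  obtain ⟨huv, s, d, haff, hend⟩ := hc i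
  have hl := Set.left_mem_Icc.2 huv.le
  have hr := Set.right_mem_Icc.2 huv.le
  refine ⟨⟨s, d, haff⟩, fun x hx => ?_, ?_, ?_⟩
  · rw [haff x hx]
    rcases le_total 0 s with hs | hs
    · have h1 := mul_le_mul_of_nonneg_left hx.1 hs
      have h2 := mul_le_mul_of_nonneg_left hx.2 hs
      rcases hend with ⟨hu, hv⟩ | ⟨hu, hv⟩ <;> constructor <;> linarith
    · have h1 := mul_le_mul_of_nonpos_left hx.1 hs
      have h2 := mul_le_mul_of_nonpos_left hx.2 hs
      rcases hend with ⟨hu, hv⟩ | ⟨hu, hv⟩ <;> constructor <;> linarith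
  · rcases hend with ⟨hu, hv⟩ | ⟨hu, hv⟩
    · exact ⟨_, hl, (haff _ hl).trans hu⟩
    · exact ⟨_, hr, (haff _ hr).trans hv⟩
  · rcases hend with ⟨hu, hv⟩ | ⟨hu, hv⟩
    · exact ⟨_, hr, (haff _ hr).trans hv⟩
    · exact ⟨_, hl, (haff _ hl).trans hu⟩

theorem pwlPiecesAtMost (hf : IsSawtooth M N f) : PWLPiecesAtMost (N + 2) f := by
  obtain ⟨c, hmono, h0, hN, hc⟩ := hf.exists_partition
  have hpieces : ∀ i : Fin (N + 2), ∃ s d : ℝ, ∀ x,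
      (∀ j : Fin (N + 1), (j : ℕ) < i → c j ≤ x) →
      (∀ j : Fin (N + 1), (i : ℕ) ≤ j → x ≤ c j) → f x = s * x + d := by
    intro i
    induction i using Fin.cases with
    | zero =>
      obtain ⟨s, d, hs⟩ := hf.affine_left
      exact ⟨s, d, fun x _ hx => hs x (h0 ▸ hx 0 (by simp))⟩
    | succ i =>
      induction i using Fin.lastCases with
      | last =>
        obtain ⟨s, d, hs⟩ := hf.affine_right
        exact ⟨s, d, fun x hx _ => hs x (hN ▸ hx (Fin.last N) (by simp))⟩
      | cast i =>
        obtain ⟨-, s, d, hs, -⟩ := hc i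
        exact ⟨s, d, fun x hl hr => hs x ⟨hl _ (by simp), hr _ (by simp)⟩⟩
  choose s d hsd using hpieces
  exact ⟨N + 1, le_rfl, c, s, d, hmono, hsd⟩

end IsSawtooth

theorem InSimplex.knot_lt {M : ℝ} (hM : 0 < M) {p : ℕ} {a : Fin p → ℝ} (ha : InSimplex M a)
    (i : Fin (p + 1)) : knot M a i.castSucc < knot M a i.succ := by
  obtain ⟨hmono, hpos, hlt⟩ := ha
  have hi := i.isLt
  unfold knot
  simp only [Fin.val_castSucc, Fin.val_succ]
  split_ifs
  all_goals first
    | omega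
    | contradiction
    | exact hM
    | exact hpos _
    | exact hlt _
    | (apply hmono
       rw [Fin.lt_def]
       simp only
       omega)

theorem IsHa.isMonotoneTooth {M : ℝ} (hM : 0 < M) {p : ℕ} {a : Fin p → ℝ} {h : ℝ → ℝ}
    (ha : InSimplex M a) (hh : IsHa M a h) (i : Fin (p + 1)) :
    IsMonotoneTooth M h (knot M a i.castSucc) (knot M a i.succ) := by
  have hlt := ha.knot_lt hM i
  have haff := hh.2.1 i
  have hval : (knotVal M p i.castSucc = 0 ∧ knotVal M p i.succ = M) ∨
      (knotVal M p i.castSucc = M ∧ knotVal M p i.succ = 0) := by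
    unfold knotVal
    simp only [Fin.val_castSucc, Fin.val_succ]
    rcases Nat.mod_two_eq_zero_or_one i with h | h
    · left
      simp [h, Nat.add_mod]
    · right
      simp [h, Nat.add_mod]
  generalize knot M a i.castSucc = u at *
  generalize knot M a i.succ = v at *
  generalize knotVal M p i.castSucc = y at *
  generalize knotVal M p i.succ = z at *
  have hvu : 0 < v - u := sub_pos.2 hlt
  refine ⟨hlt, (z - y) / (v - u), y - (z - y) / (v - u) * u, fun x hx => ?_, ?_⟩
  · have ht := haff ((x - u) / (v - u)) ⟨div_nonneg (sub_nonneg.2 hx.1) hvu.le,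
      (div_le_one hvu).2 (by linarith [hx.2])⟩
    rw [show (1 - (x - u) / (v - u)) * u + (x - u) / (v - u) * v = x by field_simp; ring] at ht
    rw [ht]
    field_simp
    ring
  · rw [show (z - y) / (v - u) * u + (y - (z - y) / (v - u) * u) = y by ring,
      show (z - y) / (v - u) * v + (y - (z - y) / (v - u) * u) = z by field_simp; ring]
    exact hval

theorem IsHa.isZigzag {M : ℝ} (hM : 0 < M) {p : ℕ} {a : Fin p → ℝ} {h : ℝ → ℝ}
    (ha : InSimplex M a) (hh : IsHa M a h) : IsZigzag M h 0 M (p + 1) := by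
  have hz : ∀ j : Fin (p + 2), IsZigzag M h 0 (knot M a j) j := by
    intro j
    induction j using Fin.induction with
    | zero => simpa [knot] using IsZigzag.nil (M := M) (f := h) 0
    | succ i ih => simpa using ih.snoc (hh.isMonotoneTooth hM ha i)
  simpa [knot] using hz (Fin.last (p + 1))

theorem IsHa.isSawtooth {M : ℝ} (hM : 0 < M) {p : ℕ} {a : Fin p → ℝ} {h : ℝ → ℝ}
    (ha : InSimplex M a) (hh : IsHa M a h) : IsSawtooth M (p + 1) h where
  zigzag := hh.isZigzag hM ha
  affine_left := ⟨0, 0, fun x hx => by simp [hh.1 x hx]⟩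
  left_nonpos x hx := (hh.1 x hx).le
  affine_right := by
    have hr := hh.2.2
    generalize (knotVal M p (Fin.last (p + 1)) - knotVal M p ⟨p, by omega⟩) /
      (M - knot M a ⟨p, by omega⟩) = s at hr
    exact ⟨s, knotVal M p (Fin.last (p + 1)) - M * s, fun x hx => by rw [hr x hx]; ring⟩
  right_outside := by
    have hlt : 0 < M - knot M a ⟨p, by omega⟩ := by
      have := ha.knot_lt hM (Fin.last p)
      simp only [Fin.succ_last] at this
      rw [show knot M a (Fin.last (p + 1)) = M by simp [knot]] at this
      exact sub_pos.2 this
    rcases Nat.mod_two_eq_zero_or_one p with hp | hp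
    · right
      intro x hx
      have h1 : knotVal M p (Fin.last (p + 1)) = M := by simp [knotVal, hp, Nat.add_mod]
      have h2 : knotVal M p ⟨p, by omega⟩ = 0 := by simp [knotVal, hp]
      rw [hh.2.2 x hx, h1, h2]
      have := mul_nonneg (sub_nonneg.2 hx) (div_nonneg (sub_nonneg.2 hM.le) hlt.le)
      linarith
    · left
      intro x hx
      have h1 : knotVal M p (Fin.last (p + 1)) = 0 := by simp [knotVal, hp, Nat.add_mod]
      have h2 : knotVal M p ⟨p, by omega⟩ = M := by simp [knotVal, hp]
      rw [hh.2.2 x hx, h1, h2]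
      have := mul_nonneg (sub_nonneg.2 hx) (div_nonneg hM.le hlt.le)
      rw [zero_sub, neg_div, mul_neg]
      linarith

theorem IsSawtooth.foldl {M : ℝ} (hM : 0 < M) {K : ℕ} (L : List (ℝ → ℝ))
    (hL : ∀ g ∈ L, IsSawtooth M K g ∧ ∀ x ≤ 0, g x = 0) {N : ℕ} {f : ℝ → ℝ}
    (hf : IsSawtooth M N f) :
    IsSawtooth M (N * K ^ L.length) (fun x => L.foldl (fun y g => g y) (f x)) := by
  induction L generalizing N f with
  | nil => simpa using hf
  | cons g L ih =>
    obtain ⟨hg, hg0⟩ := hL g (by simp)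
    have := ih (fun g' hg' => hL g' (by simp [hg'])) (hg.comp hM hg0 hf)
    simpa [pow_succ', mul_assoc] using this

/-- For `a¹, …, a^k ∈ Δ^p_M`, the composition `H = h_{a^k} ∘ ⋯ ∘ h_{a¹}` is
continuous piecewise linear with at most `(p+1)^k + 2` pieces; moreover `[0,M]` is partitioned
into exactly `(p+1)^k` subintervals on each of which `H` is affine with minimum value `0` and
maximum value `M`. -/
theorem stmt6 (M : ℝ) (hM : 0 < M) (p k : ℕ)
    (a : Fin k → Fin p → ℝ) (ha : ∀ i, InSimplex M (a i))
    (h : Fin k → ℝ → ℝ) (hh : ∀ i, IsHa M (a i) (h i)) :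
    PWLPiecesAtMost ((p+1)^k + 2) (compFold h) ∧
    PartitionAffineMinMax (compFold h) M ((p+1)^k) := by
  have hH : IsSawtooth M ((p+1)^k) (compFold h) := by
    have := IsSawtooth.foldl hM (List.ofFn h) (K := p + 1) (fun g hg => by
      obtain ⟨i, rfl⟩ := (List.mem_ofFn' h g).1 hg
      exact ⟨(hh i).isSawtooth hM (ha i), (hh i).1⟩) (IsSawtooth.id hM)
    rw [List.length_ofFn, one_mul] at this
    exact this
  exact ⟨hH.pwlPiecesAtMost, hH.partitionAffineMinMax hM⟩
end

section
/- For every k ≥ 1, w ≥ 2, M > 0 and every tuple (a¹,…,a^k) ∈ Δ^{w−1}_M × ⋯ × Δ^{w−1}_M (k factors), the function H_{a¹,…,a^k} can be represented by a ReLU DNN with k hidden layers, each of width exactly w (hence of size wk), and the interval [0,M] is partitioned into exactly w^k subintervals on each of which H_{a¹,…,a^k} is affine. Moreover, the map sending the tuple (a¹,…,a^k) to the function H_{a¹,…,a^k} is injective, i.e., distinct tuples yield distinct functions. -/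
open scoped BigOperators

/-- The alternating sequence `0, M, 0, M, …`. -/
def alternatingVal (M : ℝ) (i : ℕ) : ℝ := if i % 2 = 1 then M else 0

/-- `f` zigzags between `0` and `M` over the breakpoints `0 = c 0 < c 1 < ⋯ < c N = M`: it takes
the values `0, M, 0, M, …` there and is affine in between. -/
structure Zigzag (M : ℝ) (N : ℕ) (c : ℕ → ℝ) (f : ℝ → ℝ) : Prop where
  zero : c 0 = 0
  last : c N = M
  lt_succ : ∀ i < N, c i < c (i + 1)
  map_segment : ∀ i < N, ∀ t ∈ Set.Icc (0 : ℝ) 1,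
    f ((1 - t) * c i + t * c (i + 1)) =
      (1 - t) * alternatingVal M i + t * alternatingVal M (i + 1)

/-- The knots of `h_a`, indexed by natural numbers and prolonged by `M`. -/
def natKnot (M : ℝ) {p : ℕ} (a : Fin p → ℝ) (i : ℕ) : ℝ :=
  if i = 0 then 0 else if hi : i - 1 < p then a ⟨i - 1, hi⟩ else M

theorem alternatingVal_succ (M : ℝ) (i : ℕ) :
    alternatingVal M (i + 1) = M - alternatingVal M i := by
  unfold alternatingVal
  rcases Nat.mod_two_eq_zero_or_one i with hi | hi
  · simp [hi, Nat.add_mod]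
  · simp [hi, Nat.add_mod]

theorem alternatingVal_congr (M : ℝ) {i j : ℕ} (hij : i % 2 = j % 2) :
    alternatingVal M i = alternatingVal M j := by
  unfold alternatingVal
  rw [hij]

theorem alternatingVal_eq_or (M : ℝ) (i : ℕ) :
    alternatingVal M i = 0 ∨ alternatingVal M i = M := by
  unfold alternatingVal
  split_ifs <;> simp

theorem knot_eq_natKnot (M : ℝ) {p : ℕ} (a : Fin p → ℝ) (i : Fin (p + 2)) :
    knot M a i = natKnot M a i := by
  have := i.isLt
  unfold knot natKnot
  split_ifs <;> first | rfl | omega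

theorem InSimplex.natKnot_lt_succ {M : ℝ} {p : ℕ} {a : Fin p → ℝ} (hM : 0 < M)
    (ha : InSimplex M a) {i : ℕ} (hi : i < p + 1) : natKnot M a i < natKnot M a (i + 1) := by
  obtain ⟨hmono, hpos, hlt⟩ := ha
  unfold natKnot
  rw [if_neg i.succ_ne_zero]
  split_ifs
  any_goals omega
  · exact hpos _
  · exact hmono (Fin.mk_lt_mk.2 (by omega))
  · exact hlt _

theorem IsHa.zigzag {M : ℝ} {p : ℕ} {a : Fin p → ℝ} {h : ℝ → ℝ} (hM : 0 < M)
    (ha : InSimplex M a) (hh : IsHa M a h) : Zigzag M (p + 1) (natKnot M a) h where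
  zero := by simp [natKnot]
  last := by simp [natKnot]
  lt_succ _ hi := ha.natKnot_lt_succ hM hi
  map_segment i hi t ht := by
    have := hh.2.1 ⟨i, hi⟩ t ht
    rwa [knot_eq_natKnot, knot_eq_natKnot] at this

theorem zigzag_id {M : ℝ} (hM : 0 < M) : Zigzag M 1 (fun i => i * M) (fun x => x) where
  zero := by simp
  last := by simp
  lt_succ i hi := by push_cast; linarith
  map_segment i hi t ht := by
    obtain rfl : i = 0 := by omega
    simp [alternatingVal]

namespace Zigzag

variable {M : ℝ} {N m : ℕ} {c c' κ : ℕ → ℝ} {f f' g h : ℝ → ℝ}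

theorem le_of_le (hf : Zigzag M N c f) {i j : ℕ} (hij : i ≤ j) (hj : j ≤ N) : c i ≤ c j := by
  induction j, hij using Nat.le_induction with
  | base => rfl
  | succ j _ ih => exact (ih (by omega)).trans (hf.lt_succ j (by omega)).le

theorem lt_of_lt (hf : Zigzag M N c f) {i j : ℕ} (hij : i < j) (hj : j ≤ N) : c i < c j :=
  (hf.lt_succ i (by omega)).trans_le (hf.le_of_le hij hj)

theorem mem_Icc (hf : Zigzag M N c f) {i : ℕ} (hi : i ≤ N) : c i ∈ Set.Icc 0 M :=
  ⟨hf.zero ▸ hf.le_of_le i.zero_le hi, hf.last ▸ hf.le_of_le hi le_rfl⟩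

theorem apply_knot_succ (hf : Zigzag M N c f) {i : ℕ} (hi : i < N) :
    f (c (i + 1)) = alternatingVal M (i + 1) := by
  simpa using hf.map_segment i hi 1 (by simp)

theorem eq_of_mem_Icc (hf : Zigzag M N c f) {i : ℕ} (hi : i < N) {x : ℝ}
    (hx : x ∈ Set.Icc (c i) (c (i + 1))) :
    f x = alternatingVal M i +
      (alternatingVal M (i + 1) - alternatingVal M i) / (c (i + 1) - c i) * (x - c i) := by
  have hpos : 0 < c (i + 1) - c i := sub_pos.2 (hf.lt_succ i hi)
  have hseg := hf.map_segment i hi ((x - c i) / (c (i + 1) - c i))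
    ⟨div_nonneg (sub_nonneg.2 hx.1) hpos.le, (div_le_one hpos).2 (by linarith [hx.2])⟩
  have hxe : (1 - (x - c i) / (c (i + 1) - c i)) * c i +
      (x - c i) / (c (i + 1) - c i) * c (i + 1) = x := by
    field_simp
    ring
  rw [hxe] at hseg
  rw [hseg]
  ring

theorem not_knot_succ_lt (hM : 0 < M) (hf : Zigzag M N c f) (hf' : Zigzag M N c' f')
    (heq : Set.EqOn f f' (Set.Icc 0 M)) {i : ℕ} (hi : i < N) (hc : c i = c' i) :
    ¬ c (i + 1) < c' (i + 1) := by
  intro hlt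
  have hpos : 0 < c' (i + 1) - c' i := sub_pos.2 (hf'.lt_succ i hi)
  have hlow : c' i < c (i + 1) := hc ▸ hf.lt_succ i hi
  have h1 := hf.apply_knot_succ hi
  rw [heq (hf.mem_Icc hi), hf'.eq_of_mem_Icc hi ⟨hlow.le, hlt.le⟩] at h1
  have h2 : (alternatingVal M (i + 1) - alternatingVal M i) * (c' (i + 1) - c (i + 1)) = 0 := by
    field_simp at h1
    linarith
  rcases mul_eq_zero.1 h2 with h3 | h3
  · rw [alternatingVal_succ] at h3
    rcases alternatingVal_eq_or M i with h4 | h4 <;> rw [h4] at h3 <;> linarith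
  · linarith

/-- The breakpoints of a zigzag function are determined by its values on `[0,M]`. -/
theorem knot_unique (hM : 0 < M) (hf : Zigzag M N c f) (hf' : Zigzag M N c' f')
    (heq : Set.EqOn f f' (Set.Icc 0 M)) {i : ℕ} (hi : i ≤ N) : c i = c' i := by
  induction i with
  | zero => rw [hf.zero, hf'.zero]
  | succ i ih =>
    have hc := ih (by omega)
    exact le_antisymm (not_lt.1 (not_knot_succ_lt hM hf' hf heq.symm hi hc.symm))
      (not_lt.1 (not_knot_succ_lt hM hf hf' heq hi hc))

/-- Composing zigzag functions multiplies the numbers of pieces; the breakpoints of the inner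
function are among those of the composition, at equally spaced positions. -/
theorem comp (hM : 0 < M) (hN : 0 < N) (hg : Zigzag M N c g) (hh : Zigzag M m κ h) :
    ∃ C : ℕ → ℝ, Zigzag M (m * N) C (fun x => g (h x)) ∧ ∀ i, C (i * N) = κ i := by
  let r : ℕ → ℕ → ℝ := fun i j => if i % 2 = 0 then c j / M else 1 - c (N - j) / M
  let C : ℕ → ℝ := fun n => (1 - r (n / N) (n % N)) * κ (n / N) + r (n / N) (n % N) * κ (n / N + 1)
  have hr0 : ∀ i, r i 0 = 0 := fun i => by
    simp only [r]; split_ifs <;> simp [hg.zero, hg.last, hM.ne']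
  have hrN : ∀ i, r i N = 1 := fun i => by
    simp only [r]; split_ifs <;> simp [hg.zero, hg.last, hM.ne']
  have hrlt : ∀ i, ∀ j < N, r i j < r i (j + 1) := fun i j hj => by
    simp only [r]
    split_ifs
    · exact (div_lt_div_iff_of_pos_right hM).2 (hg.lt_succ j hj)
    · exact sub_lt_sub_left
        ((div_lt_div_iff_of_pos_right hM).2 (hg.lt_of_lt (by omega) (by omega))) _
  have hrI : ∀ i, ∀ j ≤ N, r i j ∈ Set.Icc (0 : ℝ) 1 := fun i j hj => by
    have h1 := hg.mem_Icc hj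
    have h2 := hg.mem_Icc (Nat.sub_le N j)
    have hd : ∀ y ∈ Set.Icc 0 M, y / M ∈ Set.Icc (0 : ℝ) 1 := fun y hy =>
      ⟨div_nonneg hy.1 hM.le, (div_le_one hM).2 hy.2⟩
    simp only [r]
    split_ifs
    · exact hd _ h1
    · exact ⟨by linarith [(hd _ h2).2], by linarith [(hd _ h2).1]⟩
  have hCmul : ∀ i, C (i * N) = κ i := fun i => by
    simp [C, hN, hr0]
  have hC : ∀ i, ∀ j ≤ N, C (i * N + j) = (1 - r i j) * κ i + r i j * κ (i + 1) := fun i j hj => by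
    rcases hj.lt_or_eq with hj | rfl
    · have h1 : (i * N + j) / N = i := by
        rw [mul_comm, Nat.mul_add_div hN, Nat.div_eq_of_lt hj, add_zero]
      have h2 : (i * N + j) % N = j := by
        rw [mul_comm, Nat.mul_add_mod, Nat.mod_eq_of_lt hj]
      simp only [C, h1, h2]
    · rw [show i * j + j = (i + 1) * j by ring, hCmul, hrN]
      ring
  have hdecomp : ∀ n < m * N, ∃ i < m, ∃ j < N, n = i * N + j := fun n hn =>
    ⟨n / N, (Nat.div_lt_iff_lt_mul hN).2 hn, n % N, Nat.mod_lt _ hN, by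
      rw [mul_comm]; exact (Nat.div_add_mod n N).symm⟩
  refine ⟨C, ⟨?_, ?_, ?_, ?_⟩, hCmul⟩
  · simpa [hh.zero] using hCmul 0
  · rw [hCmul, hh.last]
  · intro n hn
    obtain ⟨i, hi, j, hj, rfl⟩ := hdecomp n hn
    rw [hC i j hj.le, add_assoc, hC i (j + 1) hj]
    nlinarith [mul_pos (sub_pos.2 (hrlt i j hj)) (sub_pos.2 (hh.lt_succ i hi))]
  · intro n hn t ht
    obtain ⟨i, hi, j, hj, rfl⟩ := hdecomp n hn
    have hs : (1 - t) * r i j + t * r i (j + 1) ∈ Set.Icc (0 : ℝ) 1 :=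
      convex_Icc (0 : ℝ) 1 (hrI i j hj.le) (hrI i (j + 1) hj)
        (sub_nonneg.2 ht.2) ht.1 (by ring)
    have hx : (1 - t) * C (i * N + j) + t * C (i * N + j + 1) =
        (1 - ((1 - t) * r i j + t * r i (j + 1))) * κ i +
          ((1 - t) * r i j + t * r i (j + 1)) * κ (i + 1) := by
      rw [hC i j hj.le, add_assoc, hC i (j + 1) hj]
      ring
    simp only [hx, hh.map_segment i hi _ hs]
    rw [alternatingVal_succ]
    rcases Nat.mod_two_eq_zero_or_one i with hpar | hpar
    · have hv : alternatingVal M i = 0 := by simp [alternatingVal, hpar]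
      have hy : (1 - ((1 - t) * r i j + t * r i (j + 1))) * alternatingVal M i +
          ((1 - t) * r i j + t * r i (j + 1)) * (M - alternatingVal M i) =
          (1 - t) * c j + t * c (j + 1) := by
        simp only [hv, r, hpar, if_true]
        field_simp
        ring
      have hpar' : (i * N + j) % 2 = j % 2 := by simp [Nat.add_mod, Nat.mul_mod, hpar]
      rw [hy, hg.map_segment j hj t ht, alternatingVal_congr M hpar',
        alternatingVal_congr M (show (i * N + j + 1) % 2 = (j + 1) % 2 by omega)]
    · have hv : alternatingVal M i = M := by simp [alternatingVal, hpar]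
      have hj' : N - j = N - (j + 1) + 1 := by omega
      have hy : (1 - ((1 - t) * r i j + t * r i (j + 1))) * alternatingVal M i +
          ((1 - t) * r i j + t * r i (j + 1)) * (M - alternatingVal M i) =
          (1 - (1 - t)) * c (N - (j + 1)) + (1 - t) * c (N - (j + 1) + 1) := by
        simp only [hv, r, hpar, one_ne_zero, if_false, hj']
        field_simp
        ring
      have hpar' : (i * N + j) % 2 = (N - (j + 1) + 1) % 2 := by
        have : (i * N + j) % 2 = (N + j) % 2 := by simp [Nat.add_mod, Nat.mul_mod, hpar]
        omega
      rw [hy, hg.map_segment _ (by omega) (1 - t) ⟨by linarith [ht.2], by linarith [ht.1]⟩,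
        alternatingVal_congr M hpar',
        alternatingVal_congr M (show (i * N + j + 1) % 2 = (N - (j + 1)) % 2 by omega)]
      ring

theorem partitionAffineExact (hM : 0 < M) (hf : Zigzag M N c f) : PartitionAffineExact f M N := by
  let s : ℕ → ℝ := fun i => (alternatingVal M (i + 1) - alternatingVal M i) / (c (i + 1) - c i)
  refine ⟨fun i => c i, fun i => s i, fun i => alternatingVal M i - s i * c i,
    fun i j hij => hf.lt_of_lt hij (by omega), hf.zero, by simpa using hf.last, ?_, ?_⟩
  · intro i x hx
    rw [hf.eq_of_mem_Icc i.isLt hx]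
    ring
  · intro i j hij heq
    have hpi : 0 < c (i + 1) - c i := sub_pos.2 (hf.lt_succ i i.isLt)
    have hpj : 0 < c (i + 1 + 1) - c (i + 1) := sub_pos.2 (hf.lt_succ _ (hij ▸ j.isLt))
    simp only [s, hij] at heq
    rw [div_eq_div_iff hpi.ne' hpj.ne', alternatingVal_succ M (i + 1), alternatingVal_succ M i]
      at heq
    rcases alternatingVal_eq_or M i with hv | hv <;> rw [hv] at heq <;>
      nlinarith [mul_pos hM hpi, mul_pos hM hpj]

end Zigzag

/-- `h_a` is a linear combination of `p + 1` shifted ReLUs. -/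
theorem IsHa.exists_eq_sum_relu {M : ℝ} {p : ℕ} {a : Fin p → ℝ} {h : ℝ → ℝ} (hM : 0 < M)
    (ha : InSimplex M a) (hh : IsHa M a h) :
    ∃ u θ : Fin (p + 1) → ℝ, ∀ x, h x = ∑ j, u j * max (x - θ j) 0 := by
  have hz := hh.zigzag hM ha
  set κ := natKnot M a
  let s : ℕ → ℝ := fun i => (alternatingVal M (i + 1) - alternatingVal M i) / (κ (i + 1) - κ i)
  let u : ℕ → ℝ := fun i => s i - if i = 0 then 0 else s (i - 1)
  have hlin : ∀ x, ∀ i < p + 1, ∑ j ∈ Finset.range (i + 1), u j * (x - κ j) =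
      alternatingVal M i + s i * (x - κ i) := by
    intro x i hi
    induction i with
    | zero => simp [u, alternatingVal]
    | succ i ih =>
      have hs : s i * (κ (i + 1) - κ i) = alternatingVal M (i + 1) - alternatingVal M i :=
        div_mul_cancel₀ _ (sub_pos.2 (hz.lt_succ i (by omega))).ne'
      rw [Finset.sum_range_succ, ih (by omega)]
      simp only [u, Nat.add_sub_cancel, Nat.succ_ne_zero, if_false]
      linarith
  refine ⟨fun j => u j, fun j => κ j, fun x => ?_⟩
  rw [Fin.sum_univ_eq_sum_range (fun j => u j * max (x - κ j) 0) (p + 1)]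
  rcases le_total x 0 with hx | hx
  · rw [hh.1 x hx, Finset.sum_eq_zero]
    intro j hj
    rw [max_eq_right, mul_zero]
    linarith [(hz.mem_Icc (Finset.mem_range.1 hj).le).1]
  · obtain ⟨i, hi, hix, hxi⟩ : ∃ i < p + 1, κ i ≤ x ∧ ∀ j, i < j → j < p + 1 → x ≤ κ j := by
      have hP : κ 0 ≤ x := hz.zero.symm ▸ hx
      refine ⟨Nat.findGreatest (fun i => κ i ≤ x) p, Nat.lt_succ_of_le (Nat.findGreatest_le p),
        Nat.findGreatest_spec (P := fun i => κ i ≤ x) p.zero_le hP, fun j hj hjp => ?_⟩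
      exact (not_le.1 (Nat.findGreatest_is_greatest (P := fun i => κ i ≤ x) hj
        (Nat.lt_succ_iff.1 hjp))).le
    have hsum : ∑ j ∈ Finset.range (p + 1), u j * max (x - κ j) 0 =
        ∑ j ∈ Finset.range (i + 1), u j * (x - κ j) := by
      rw [← Finset.sum_subset (Finset.range_mono (show i + 1 ≤ p + 1 by omega))]
      · refine Finset.sum_congr rfl fun j hj => ?_
        rw [max_eq_left]
        linarith [hz.le_of_le (Nat.lt_succ_iff.1 (Finset.mem_range.1 hj)) hi.le]
      · intro j hj hj'
        simp only [Finset.mem_range] at hj hj'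
        rw [max_eq_right, mul_zero]
        linarith [hxi j (by omega) hj]
    rw [hsum, hlin x i hi]
    rcases le_total x (κ (i + 1)) with hle | hge
    · exact hz.eq_of_mem_Icc hi ⟨hix, hle⟩
    · by_cases hip : i + 1 < p + 1
      · exact hz.eq_of_mem_Icc hi ⟨hix, hxi _ (by omega) hip⟩
      · obtain rfl : i = p := by omega
        rw [hz.last] at hge
        have hs : s i * (M - κ i) = alternatingVal M (i + 1) - alternatingVal M i := by
          simp only [s, hz.last]
          have hpos := hz.lt_succ i hi
          rw [hz.last] at hpos
          exact div_mul_cancel₀ _ (sub_pos.2 hpos).ne'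
        have hcont : h x = alternatingVal M (i + 1) + (x - M) * s i := by
          have := hh.2.2 x hge
          rw [knot_eq_natKnot] at this
          simp only [s, hz.last]
          exact this
        rw [hcont]
        linarith

theorem compFold_zero (h : Fin 0 → ℝ → ℝ) : compFold h = fun x => x := by
  funext x
  simp [compFold]

theorem compFold_succ {k : ℕ} (h : Fin (k + 1) → ℝ → ℝ) (x : ℝ) :
    compFold h x = compFold (fun i => h i.succ) (h 0 x) := by
  simp [compFold, List.ofFn_succ]

theorem exists_zigzag_compFold {M : ℝ} (hM : 0 < M) {p k : ℕ} {a : Fin k → Fin p → ℝ}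
    (ha : ∀ i, InSimplex M (a i)) {h : Fin k → ℝ → ℝ} (hh : ∀ i, IsHa M (a i) (h i)) :
    ∃ c, Zigzag M ((p + 1) ^ k) c (compFold h) := by
  induction k with
  | zero => exact ⟨_, by rw [compFold_zero, pow_zero]; exact zigzag_id hM⟩
  | succ k ih =>
    obtain ⟨c, hc⟩ := ih (fun i => ha i.succ) (fun i => hh i.succ)
    obtain ⟨C, hC, -⟩ := hc.comp hM (by positivity) ((hh 0).zigzag hM (ha 0))
    refine ⟨C, ?_⟩
    rw [pow_succ', funext (compFold_succ h)]
    exact hC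

theorem eq_of_eqOn_compFold {M : ℝ} (hM : 0 < M) {p k : ℕ} {a a' : Fin k → Fin p → ℝ}
    (ha : ∀ i, InSimplex M (a i)) (ha' : ∀ i, InSimplex M (a' i)) {h h' : Fin k → ℝ → ℝ}
    (hh : ∀ i, IsHa M (a i) (h i)) (hh' : ∀ i, IsHa M (a' i) (h' i))
    (heq : Set.EqOn (compFold h) (compFold h') (Set.Icc 0 M)) : a = a' := by
  induction k with
  | zero => exact Subsingleton.elim _ _
  | succ k ih =>
    have hz := (hh 0).zigzag hM (ha 0)
    have hz' := (hh' 0).zigzag hM (ha' 0)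
    obtain ⟨c, hc⟩ := exists_zigzag_compFold hM (fun i => ha i.succ) (fun i => hh i.succ)
    obtain ⟨c', hc'⟩ := exists_zigzag_compFold hM (fun i => ha' i.succ) (fun i => hh' i.succ)
    have hpow : 0 < (p + 1) ^ k := by positivity
    obtain ⟨C, hC, hCκ⟩ := hc.comp hM hpow hz
    obtain ⟨C', hC', hCκ'⟩ := hc'.comp hM hpow hz'
    rw [funext (compFold_succ h), funext (compFold_succ h')] at heq
    have hκ : ∀ i ≤ p + 1, natKnot M (a 0) i = natKnot M (a' 0) i := fun i hi => by
      rw [← hCκ, ← hCκ']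
      exact hC.knot_unique hM hC' heq (Nat.mul_le_mul_right _ hi)
    have h0 : a 0 = a' 0 := by
      funext i
      simpa [natKnot] using hκ (i + 1) (by omega)
    have htail : (fun i : Fin k => a i.succ) = fun i => a' i.succ := by
      refine ih (fun i => ha i.succ) (fun i => ha' i.succ) (fun i => hh i.succ)
        (fun i => hh' i.succ) fun y hy => ?_
      have ht : y / M ∈ Set.Icc (0 : ℝ) 1 := ⟨div_nonneg hy.1 hM.le, (div_le_one hM).2 hy.2⟩
      have hval : (1 - y / M) * alternatingVal M 0 + y / M * alternatingVal M (0 + 1) = y := by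
        simp [alternatingVal, hM.ne']
      have h1 := hz.map_segment 0 (by omega) _ ht
      have h2 := hz'.map_segment 0 (by omega) _ ht
      have hx : (1 - y / M) * natKnot M (a 0) 0 + y / M * natKnot M (a 0) (0 + 1) ∈
          Set.Icc 0 M :=
        convex_Icc 0 M (hz.mem_Icc (by omega)) (hz.mem_Icc (by omega))
          (sub_nonneg.2 ht.2) ht.1 (by ring)
      have h3 := heq hx
      rw [← hκ 0 (by omega), ← hκ (0 + 1) (by omega)] at h2
      simpa only [h1, h2, hval] using h3
    funext i
    exact Fin.cases h0 (fun j => congrFun htail j) i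

theorem representsWithAux_compFold {M : ℝ} (hM : 0 < M) {p k : ℕ} {a : Fin k → Fin p → ℝ}
    (ha : ∀ i, InSimplex M (a i)) {h : Fin k → ℝ → ℝ} (hh : ∀ i, IsHa M (a i) (h i))
    {n : ℕ} (b : Fin n → ℝ) :
    RepresentsWithAux (List.replicate k (p + 1)) n 1
      (fun x _ => compFold h (∑ j, b j * x j)) := by
  induction k generalizing n with
  | zero =>
    refine ⟨fun _ => b, fun x => ?_⟩
    funext i
    simp [compFold_zero, Matrix.mulVec, dotProduct]
  | succ k ih =>
    obtain ⟨u, θ, hu⟩ := (hh 0).exists_eq_sum_relu hM (ha 0)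
    refine ⟨fun x j => ∑ l, b l * x l - θ j, _, ⟨fun _ => b, fun j => -θ j, fun x => ?_⟩,
      ih (fun i => ha i.succ) (fun i => hh i.succ) u, fun x => ?_⟩
    · funext j
      simp [Matrix.mulVec, dotProduct, sub_eq_add_neg]
    · funext i
      simp only [compFold_succ, hu, reluVec]

/-- For `k ≥ 1`, `w ≥ 2`, `M > 0` and `(a¹, …, a^k) ∈ (Δ^{w-1}_M)^k`, the function
`H_{a¹,…,a^k}` is representable by a ReLU DNN with `k` hidden layers each of width `w`; `[0,M]`
is partitioned into exactly `w^k` subintervals of affinity; and distinct tuples give distinct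
functions. -/
theorem stmt7 (k w : ℕ) (hk : 1 ≤ k) (hw : 2 ≤ w) (M : ℝ) (hM : 0 < M)
    (a : Fin k → Fin (w-1) → ℝ) (ha : ∀ i, InSimplex M (a i))
    (h : Fin k → ℝ → ℝ) (hh : ∀ i, IsHa M (a i) (h i)) :
    Represents1D (List.replicate k w) (compFold h) ∧
    PartitionAffineExact (compFold h) M (w ^ k) ∧
    (∀ (a' : Fin k → Fin (w-1) → ℝ), (∀ i, InSimplex M (a' i)) →
      ∀ h' : Fin k → ℝ → ℝ, (∀ i, IsHa M (a' i) (h' i)) →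
        compFold h = compFold h' → a = a') := by
  obtain ⟨p, rfl⟩ : ∃ p, w = p + 1 := ⟨w - 1, by omega⟩
  refine ⟨?_, ?_, fun a' ha' h' hh' heq => ?_⟩
  · have := representsWithAux_compFold (p := p) hM ha hh (fun _ : Fin 1 => 1)
    simpa [Represents1D, RepresentsWith] using this
  · obtain ⟨c, hc⟩ := exists_zigzag_compFold (p := p) hM ha hh
    exact hc.partitionAffineExact hM
  · exact eq_of_eqOn_compFold (p := p) hM ha ha' hh hh' fun x _ => congrFun heq x
end

section
/- For every k ≥ 1, w ≥ 2, M > 0 and every tuple (a¹,…,a^k) ∈ Δ^{w−1}_M × ⋯ × Δ^{w−1}_M (k factors): if the function H_{a¹,…,a^k} is represented by a ReLU DNN with k' hidden layers for some 1 ≤ k' ≤ k, then the size of that DNN is at least (1/2)·k'·w^{k/k'} − 1. -/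
open scoped BigOperators

/-- `F` is affine on each of at most `P` order-connected cells covering the line. -/
def HasAffineCells (P : ℕ) {n : ℕ} (F : ℝ → Fin n → ℝ) : Prop :=
  ∃ idx : ℝ → Fin P, (∀ p, (idx ⁻¹' {p}).OrdConnected) ∧
    ∀ p, ∃ A c : Fin n → ℝ, ∀ x, idx x = p → ∀ j, F x j = A j * x + c j

lemma HasAffineCells.mulVec_add {P n m : ℕ} {F : ℝ → Fin n → ℝ} (hF : HasAffineCells P F)
    (B : Matrix (Fin m) (Fin n) ℝ) (b : Fin m → ℝ) :
    HasAffineCells P (fun x => B.mulVec (F x) + b) := by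
  obtain ⟨idx, hidx, hA⟩ := hF
  refine ⟨idx, hidx, fun p => ?_⟩
  obtain ⟨A, c, hAc⟩ := hA p
  refine ⟨B.mulVec A, B.mulVec c + b, fun x hx j => ?_⟩
  simp only [Pi.add_apply, Matrix.mulVec, dotProduct, hAc x hx, Finset.sum_mul]
  rw [← add_assoc, ← Finset.sum_add_distrib]
  congr 1
  exact Finset.sum_congr rfl fun i _ => by ring

lemma HasAffineCells.reluVec {P n : ℕ} {F : ℝ → Fin n → ℝ} (hF : HasAffineCells P F) :
    HasAffineCells (P * (n + 1)) (fun x => reluVec (F x)) := by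
  classical
  obtain ⟨idx, hidx, hA⟩ := hF
  choose A c hAc using hA
  -- the cell `p` is cut at the zeros `-c/A` of the coordinates
  let below : Fin P → ℝ → Finset (Fin n) := fun p x => {j | -c p j / A p j < x}
  have hmono (p : Fin P) {x y : ℝ} (hxy : x ≤ y) : below p x ⊆ below p y := by
    intro j hj
    simp only [below, Finset.mem_filter, Finset.mem_univ, true_and] at hj ⊢
    exact hj.trans_le hxy
  have hlt (p : Fin P) (x : ℝ) : (below p x).card < n + 1 :=
    Nat.lt_succ_of_le ((Finset.card_le_univ _).trans_eq (Fintype.card_fin n))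
  have hsign (p : Fin P) (x y : ℝ) (hxy : (below p x).card = (below p y).card) (j : Fin n)
      (hx : 0 < A p j * x + c p j) (hy : A p j * y + c p j < 0) : False := by
    have hne : A p j ≠ 0 := by
      intro h0
      rw [h0] at hx hy
      linarith
    have hbelow : below p x = below p y := by
      rcases le_total x y with h | h
      · exact Finset.eq_of_subset_of_card_le (hmono p h) hxy.ge
      · exact (Finset.eq_of_subset_of_card_le (hmono p h) hxy.le).symm
    have hj : -c p j / A p j < x ↔ -c p j / A p j < y := by
      simpa [below] using Finset.ext_iff.1 hbelow j
    rcases lt_or_gt_of_ne hne with hneg | hpos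
    · rw [div_lt_iff_of_neg hneg, div_lt_iff_of_neg hneg] at hj
      have := hj.2 (by linarith)
      linarith
    · rw [div_lt_iff₀ hpos, div_lt_iff₀ hpos] at hj
      have := hj.1 (by linarith)
      linarith
  refine ⟨fun x => finProdFinEquiv (idx x, ⟨(below (idx x) x).card, hlt _ _⟩), fun q => ?_,
    fun q => ?_⟩
  · obtain ⟨⟨p, r⟩, rfl⟩ := finProdFinEquiv.surjective q
    refine ⟨fun x hx y hy z hz => ?_⟩
    simp only [Set.mem_preimage, Set.mem_singleton_iff, EmbeddingLike.apply_eq_iff_eq,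
      Prod.mk.injEq, Fin.ext_iff] at hx hy ⊢
    have hzp : idx z = p := (hidx p).out (Fin.ext hx.1) (Fin.ext hy.1) hz
    have hxp : idx x = p := Fin.ext hx.1
    have hyp : idx y = p := Fin.ext hy.1
    rw [hxp] at hx
    rw [hyp] at hy
    rw [hzp]
    exact ⟨rfl, le_antisymm ((Finset.card_le_card (hmono p hz.2)).trans_eq hy.2)
      (hx.2.symm.trans_le (Finset.card_le_card (hmono p hz.1)))⟩
  · obtain ⟨⟨p, r⟩, rfl⟩ := finProdFinEquiv.surjective q
    have key (j : Fin n) : ∃ s d : ℝ, ∀ x, idx x = p → (below p x).card = r →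
        max (F x j) 0 = s * x + d := by
      by_cases hpos : ∃ x, idx x = p ∧ (below p x).card = r ∧ 0 < A p j * x + c p j
      · obtain ⟨x, -, hxr, hx⟩ := hpos
        refine ⟨A p j, c p j, fun y hy hyr => ?_⟩
        rw [hAc p y hy]
        exact max_eq_left (not_lt.1 fun h => hsign p x y (hxr.trans hyr.symm) j hx h)
      · push Not at hpos
        refine ⟨0, 0, fun y hy hyr => ?_⟩
        rw [hAc p y hy, max_eq_right (hpos y hy hyr)]
        ring
    choose s d hsd using key
    refine ⟨s, d, fun x hx j => ?_⟩
    simp only [EmbeddingLike.apply_eq_iff_eq, Prod.mk.injEq, Fin.ext_iff] at hx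
    have hxp : idx x = p := Fin.ext hx.1
    rw [hxp] at hx
    exact hsd j x hxp hx.2

lemma HasAffineCells.comp_represents (ws : List ℕ) {P n m : ℕ} {F : ℝ → Fin n → ℝ}
    {f : (Fin n → ℝ) → Fin m → ℝ} (hF : HasAffineCells P F) (hf : RepresentsWithAux ws n m f) :
    HasAffineCells (P * (ws.map (· + 1)).prod) (fun x => f (F x)) := by
  induction ws generalizing P n with
  | nil =>
    obtain ⟨B, hB⟩ := hf
    simpa [hB] using hF.mulVec_add B 0
  | cons v ws ih =>
    obtain ⟨T, g, ⟨B, b, hT⟩, hg, hfg⟩ := hf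
    have := ih (hF.mulVec_add B b).reluVec hg
    simpa [hfg, hT, mul_assoc] using this

lemma Represents1D.hasAffineCells {ws : List ℕ} {f : ℝ → ℝ} (hf : Represents1D ws f) :
    HasAffineCells (ws.map (· + 1)).prod (fun x => fun _ : Fin 1 => f x) := by
  have hid : HasAffineCells 1 (fun x : ℝ => fun _ : Fin 1 => x) :=
    ⟨fun _ => 0, fun p => by
      rw [Subsingleton.elim p 0]
      simpa using Set.ordConnected_univ, fun _ => ⟨1, 0, by simp⟩⟩
  simpa using hid.comp_represents ws hf

/-- A function with `P` affine cells that is constant on no interval inside `[0, M]` attains each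
value at most `P` times there. -/
lemma HasAffineCells.card_level_le {P : ℕ} {f : ℝ → ℝ} {M v : ℝ}
    (hf : HasAffineCells P (fun x => fun _ : Fin 1 => f x))
    (hconst : ∀ x ∈ Set.Icc 0 M, ∀ y ∈ Set.Icc 0 M, x < y →
      ¬ ∃ u, ∀ z ∈ Set.Icc x y, f z = u)
    (S : Finset ℝ) (hS : ∀ x ∈ S, x ∈ Set.Icc 0 M ∧ f x = v) : S.card ≤ P := by
  obtain ⟨idx, hidx, hA⟩ := hf
  have hlt (x y : ℝ) (hx : x ∈ S) (hy : y ∈ S) (hxy : x < y) : idx x ≠ idx y := by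
    intro hi
    obtain ⟨A, c, hAc⟩ := hA (idx y)
    have h1 := hAc x hi 0
    have h2 := hAc y rfl 0
    simp only [(hS x hx).2, (hS y hy).2] at h1 h2
    have h0 : A 0 = 0 := by
      have : A 0 * (y - x) = 0 := by linarith
      exact (mul_eq_zero.1 this).resolve_right (sub_ne_zero.2 hxy.ne')
    refine hconst x (hS x hx).1 y (hS y hy).1 hxy ⟨c 0, fun z hz => ?_⟩
    have := hAc z ((hidx (idx y)).out hi rfl hz) 0
    simpa [h0] using this
  have hinj : Set.InjOn idx S := by
    intro x hx y hy hi
    rcases lt_trichotomy x y with h | h | h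
    · exact absurd hi (hlt x y hx hy h)
    · exact h
    · exact absurd hi.symm (hlt y x hy hx h)
  simpa using Finset.card_le_card_of_injOn idx (fun _ _ => Finset.mem_univ _) hinj

lemma knot_zero (M : ℝ) {p : ℕ} (a : Fin p → ℝ) : knot M a 0 = 0 := by
  simp [knot]

lemma knot_last (M : ℝ) {p : ℕ} (a : Fin p → ℝ) : knot M a (Fin.last (p + 1)) = M := by
  simp [knot]

lemma InSimplex.strictMono_knot {M : ℝ} (hM : 0 < M) {p : ℕ} {a : Fin p → ℝ}
    (ha : InSimplex M a) : StrictMono (knot M a) := by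
  obtain ⟨hmono, hpos, hlt⟩ := ha
  intro i j hij
  have hij' : (i : ℕ) < j := hij
  have := j.isLt
  unfold knot
  split_ifs <;> first
    | omega
    | exact hM
    | exact hpos _
    | exact hlt _
    | exact hmono (by simp only [Fin.lt_def]; omega)

lemma exists_knot_le_lt {M : ℝ} {p : ℕ} (a : Fin p → ℝ)
    {x : ℝ} (hx0 : 0 ≤ x) (hxM : x < M) :
    ∃ i : Fin (p + 1), knot M a i.castSucc ≤ x ∧ x < knot M a i.succ := by
  by_contra! hcon
  have hall (i : Fin (p + 2)) : knot M a i ≤ x := by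
    induction i using Fin.induction with
    | zero => rwa [knot_zero]
    | succ i ih => exact hcon i ih
  exact absurd (hall (Fin.last _)) (by rw [knot_last]; exact not_le.2 hxM)

/-- On every knot interval, `h_a` is the affine parametrization of `[0, M]`, in one of the two
directions. -/
lemma IsHa.apply_knot_segment {M : ℝ} {p : ℕ} {a : Fin p → ℝ} {h : ℝ → ℝ} (hh : IsHa M a h)
    (i : Fin (p + 1)) :
    (∀ t ∈ Set.Icc (0:ℝ) 1,
      h ((1 - t) * knot M a i.castSucc + t * knot M a i.succ) = t * M) ∨
    (∀ t ∈ Set.Icc (0:ℝ) 1,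
      h ((1 - t) * knot M a i.castSucc + t * knot M a i.succ) = (1 - t) * M) := by
  rcases Nat.mod_two_eq_zero_or_one i with hi | hi
  · left
    intro t ht
    rw [hh.2.1 i t ht]
    simp [knotVal, hi, Nat.add_mod]
  · right
    intro t ht
    rw [hh.2.1 i t ht]
    simp [knotVal, hi, Nat.add_mod]

lemma IsHa.exists_preimages {M : ℝ} (hM : 0 < M) {p : ℕ} {a : Fin p → ℝ} {h : ℝ → ℝ}
    (ha : InSimplex M a) (hh : IsHa M a h) (S : Finset ℝ) (hS : ∀ v ∈ S, v ∈ Set.Ioo 0 M) :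
    ∃ S' : Finset ℝ, S'.card = (p + 1) * S.card ∧ ∀ x ∈ S', x ∈ Set.Ioo 0 M ∧ h x ∈ S := by
  classical
  have hmono := ha.strictMono_knot hM
  have hpre (i : Fin (p + 1)) (v : ℝ) (hv : v ∈ Set.Ioo 0 M) :
      ∃ x ∈ Set.Ioo (knot M a i.castSucc) (knot M a i.succ), h x = v := by
    have hlt : knot M a i.castSucc < knot M a i.succ := hmono Fin.castSucc_lt_succ
    have ht0 : 0 < v / M := div_pos hv.1 hM
    have ht1 : v / M < 1 := (div_lt_one hM).2 hv.2
    rcases hh.apply_knot_segment i with hi | hi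
    · refine ⟨_, ⟨?_, ?_⟩, (hi (v / M) ⟨ht0.le, ht1.le⟩).trans (by field_simp)⟩ <;> nlinarith
    · refine ⟨_, ⟨?_, ?_⟩, (hi (1 - v / M) ⟨by linarith, by linarith⟩).trans
        (by field_simp; ring)⟩ <;> nlinarith
  choose! g hg hgv using hpre
  have hsep (i j : Fin (p + 1)) (hij : i < j) (v u : ℝ) (hv : v ∈ S) (hu : u ∈ S) :
      g i v < g j u :=
    (hg i v (hS v hv)).2.trans_le ((hmono.monotone (Fin.succ_le_castSucc_iff.2 hij)).trans
      (hg j u (hS u hu)).1.le)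
  refine ⟨((Finset.univ : Finset (Fin (p + 1))) ×ˢ S).image fun q => g q.1 q.2, ?_, ?_⟩
  · rw [Finset.card_image_of_injOn, Finset.card_product, Finset.card_univ, Fintype.card_fin]
    rintro ⟨i, v⟩ hv ⟨j, u⟩ hu huv
    replace hv : v ∈ S := by simpa using hv
    replace hu : u ∈ S := by simpa using hu
    simp only at huv
    rcases lt_trichotomy i j with hij | rfl | hij
    · exact absurd huv (hsep i j hij v u hv hu).ne
    · rw [← hgv i v (hS v hv), huv, hgv i u (hS u hu)]
    · exact absurd huv (hsep j i hij u v hu hv).ne'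
  · intro x hx
    simp only [Finset.mem_image, Finset.mem_product, Finset.mem_univ, true_and] at hx
    obtain ⟨⟨i, v⟩, hv, rfl⟩ := hx
    refine ⟨⟨?_, ?_⟩, by simpa only [hgv i v (hS v hv)] using hv⟩
    · have := hmono.monotone (Fin.zero_le i.castSucc)
      rw [knot_zero] at this
      exact this.trans_lt (hg i v (hS v hv)).1
    · have := hmono.monotone (Fin.le_last i.succ)
      rw [knot_last] at this
      exact (hg i v (hS v hv)).2.trans_le this

lemma IsHa.exists_Icc_subset_image {M : ℝ} (hM : 0 < M) {p : ℕ} {a : Fin p → ℝ} {h : ℝ → ℝ}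
    (hh : IsHa M a h) {x y : ℝ} (hx : x ∈ Set.Icc 0 M)
    (hy : y ∈ Set.Icc 0 M) (hxy : x < y) :
    ∃ x' ∈ Set.Icc 0 M, ∃ y' ∈ Set.Icc 0 M, x' < y' ∧ Set.Icc x' y' ⊆ h '' Set.Icc x y := by
  obtain ⟨i, hix, hxi⟩ := exists_knot_le_lt a hx.1 (hxy.trans_le hy.2)
  have hseg := hh.apply_knot_segment i
  set l := knot M a i.castSucc
  set r := knot M a i.succ
  have hlr : 0 < r - l := by linarith
  obtain ⟨s, hs, hst⟩ : ∃ s, x = (1 - s) * l + s * r ∧ 0 ≤ s :=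
    ⟨(x - l) / (r - l), by field_simp; ring, div_nonneg (by linarith) hlr.le⟩
  obtain ⟨t, ht, hty, ht1⟩ : ∃ t, s < t ∧ (1 - t) * l + t * r ≤ y ∧ t ≤ 1 := by
    refine ⟨(min y r - l) / (r - l), ?_, ?_, ?_⟩
    · rw [lt_div_iff₀ hlr]
      have := lt_min hxy hxi
      linarith
    · have : (1 - (min y r - l) / (r - l)) * l + (min y r - l) / (r - l) * r = min y r := by
        field_simp
        ring
      rw [this]
      exact min_le_left _ _
    · rw [div_le_one hlr]
      linarith [min_le_right y r]
  have hmem (q : ℝ) (hq : q ∈ Set.Icc s t) : (1 - q) * l + q * r ∈ Set.Icc x y :=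
    ⟨by nlinarith [hq.1], by nlinarith [hq.2]⟩
  rcases hseg with hseg | hseg
  · refine ⟨s * M, ⟨by positivity, by nlinarith⟩, t * M, ⟨by nlinarith, by nlinarith⟩,
      by nlinarith, fun z hz => ?_⟩
    have h1 : s ≤ z / M := (le_div_iff₀ hM).2 hz.1
    have h2 : z / M ≤ t := (div_le_iff₀ hM).2 hz.2
    refine ⟨_, hmem (z / M) ⟨h1, h2⟩, ?_⟩
    rw [hseg _ ⟨by linarith, by linarith⟩]
    field_simp
  · refine ⟨(1 - t) * M, ⟨by nlinarith, by nlinarith⟩, (1 - s) * M,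
      ⟨by nlinarith, by nlinarith⟩, by nlinarith, fun z hz => ?_⟩
    have h1 : 1 - t ≤ z / M := (le_div_iff₀ hM).2 hz.1
    have h2 : z / M ≤ 1 - s := (div_le_iff₀ hM).2 hz.2
    refine ⟨_, hmem (1 - z / M) ⟨by linarith, by linarith⟩, ?_⟩
    rw [hseg _ ⟨by linarith, by linarith⟩]
    field_simp
    ring

lemma exists_level_set_foldl {M : ℝ} (hM : 0 < M) {p : ℕ} (L : List (ℝ → ℝ))
    (hL : ∀ h ∈ L, ∃ a : Fin p → ℝ, InSimplex M a ∧ IsHa M a h) {v : ℝ} (hv : v ∈ Set.Ioo 0 M) :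
    ∃ S : Finset ℝ, S.card = (p + 1) ^ L.length ∧
      ∀ x ∈ S, x ∈ Set.Ioo 0 M ∧ L.foldl (fun y g => g y) x = v := by
  induction L with
  | nil => exact ⟨{v}, by simpa using hv⟩
  | cons h L ih =>
    obtain ⟨S, hcard, hS⟩ := ih fun g hg => hL g (List.mem_cons_of_mem _ hg)
    obtain ⟨a, ha, hh⟩ := hL h List.mem_cons_self
    obtain ⟨S', hcard', hS'⟩ := hh.exists_preimages hM ha S fun x hx => (hS x hx).1
    refine ⟨S', by rw [hcard', hcard, List.length_cons, pow_succ'], fun x hx => ?_⟩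
    exact ⟨(hS' x hx).1, (hS _ (hS' x hx).2).2⟩

lemma foldl_not_constant {M : ℝ} (hM : 0 < M) {p : ℕ} (L : List (ℝ → ℝ))
    (hL : ∀ h ∈ L, ∃ a : Fin p → ℝ, IsHa M a h) {x y : ℝ} (hx : x ∈ Set.Icc 0 M)
    (hy : y ∈ Set.Icc 0 M) (hxy : x < y) :
    ¬ ∃ u, ∀ z ∈ Set.Icc x y, L.foldl (fun y g => g y) z = u := by
  induction L generalizing x y with
  | nil =>
    rintro ⟨u, hu⟩
    have h1 := hu x ⟨le_rfl, hxy.le⟩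
    have h2 := hu y ⟨hxy.le, le_rfl⟩
    simp only [List.foldl_nil] at h1 h2
    linarith
  | cons h L ih =>
    rintro ⟨u, hu⟩
    obtain ⟨a, hh⟩ := hL h List.mem_cons_self
    obtain ⟨x', hx', y', hy', hxy', hsub⟩ := hh.exists_Icc_subset_image hM hx hy hxy
    refine ih (fun g hg => hL g (List.mem_cons_of_mem _ hg)) hx' hy' hxy' ⟨u, fun z hz => ?_⟩
    obtain ⟨q, hq, rfl⟩ := hsub hz
    exact hu q hq

/-- The inequality of arithmetic and geometric means for lists of natural numbers. -/
lemma List.prod_le_sum_div_length_pow (l : List ℕ) (hl : l ≠ []) :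
    (l.prod : ℝ) ≤ ((l.sum : ℝ) / l.length) ^ l.length := by
  have hpos : (0 : ℝ) < l.length := by exact_mod_cast List.length_pos_iff.2 hl
  have h := Real.geom_mean_le_arith_mean (Finset.univ : Finset (Fin l.length)) (fun _ => 1)
    (fun i => (l[i] : ℝ)) (by simp) (by simpa using hpos) (by simp)
  have hprod : ∏ i : Fin l.length, ((l[i] : ℕ) : ℝ) = l.prod := by
    rw [← Nat.cast_prod]
    congr 1
    exact Fin.prod_univ_getElem l
  have hsum : ∑ i : Fin l.length, ((l[i] : ℕ) : ℝ) = l.sum := by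
    rw [← Nat.cast_sum]
    congr 1
    exact Fin.sum_univ_getElem l
  simp only [Real.rpow_one, one_mul, Finset.sum_const, Finset.card_univ, Fintype.card_fin,
    nsmul_eq_mul, mul_one, hprod, hsum] at h
  calc (l.prod : ℝ) = ((l.prod : ℝ) ^ ((l.length : ℝ)⁻¹)) ^ l.length := by
        rw [Real.rpow_inv_natCast_pow (by positivity) (by exact_mod_cast hpos.ne')]
    _ ≤ _ := pow_le_pow_left₀ (by positivity) h _

/-- For `k ≥ 1`, `w ≥ 2`, any ReLU DNN with `k'` hidden layers (`1 ≤ k' ≤ k`)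
representing `H_{a¹,…,a^k}` has size at least `(1/2)·k'·w^{k/k'} − 1`. -/
theorem stmt8 (k w : ℕ) (hk : 1 ≤ k) (hw : 2 ≤ w) (M : ℝ) (hM : 0 < M)
    (a : Fin k → Fin (w-1) → ℝ) (ha : ∀ i, InSimplex M (a i))
    (h : Fin k → ℝ → ℝ) (hh : ∀ i, IsHa M (a i) (h i))
    (k' : ℕ) (hk'1 : 1 ≤ k') (hk'k : k' ≤ k)
    (ws : List ℕ) (hlen : ws.length = k') (hrep : Represents1D ws (compFold h)) :
    (1/2 : ℝ) * (k' : ℝ) * (w : ℝ) ^ ((k : ℝ) / (k' : ℝ)) - 1 ≤ (ws.sum : ℝ) := by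
  have hL : ∀ g ∈ List.ofFn h, ∃ b : Fin (w - 1) → ℝ, InSimplex M b ∧ IsHa M b g := by
    intro g hg
    obtain ⟨i, rfl⟩ := (List.mem_ofFn' h g).1 hg
    exact ⟨a i, ha i, hh i⟩
  obtain ⟨S, hcard, hS⟩ := exists_level_set_foldl hM (List.ofFn h) hL
    (v := M / 2) ⟨by linarith, by linarith⟩
  have hpieces : w ^ k ≤ (ws.map (· + 1)).prod := by
    have := hrep.hasAffineCells.card_level_le
      (fun x hx y hy hxy => foldl_not_constant hM (List.ofFn h)
        (fun g hg => (hL g hg).imp fun _ hb => hb.2) hx hy hxy)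
      S (fun x hx => ⟨Set.Ioo_subset_Icc_self (hS x hx).1, (hS x hx).2⟩)
    rwa [hcard, List.length_ofFn, Nat.sub_add_cancel (by omega)] at this
  have hk'pos : (0 : ℝ) < k' := by exact_mod_cast hk'1
  have hw2 : (2 : ℝ) ≤ w := by exact_mod_cast hw
  have hX2 : (2 : ℝ) ≤ (w : ℝ) ^ ((k : ℝ) / (k' : ℝ)) := by
    refine hw2.trans (Real.self_le_rpow_of_one_le (by linarith) ?_)
    rw [one_le_div hk'pos]
    exact_mod_cast hk'k
  have hXpow : ((w : ℝ) ^ ((k : ℝ) / (k' : ℝ))) ^ k' = (w : ℝ) ^ k := by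
    rw [← Real.rpow_natCast, ← Real.rpow_mul (by linarith), div_mul_cancel₀ _ hk'pos.ne',
      Real.rpow_natCast]
  have hamgm := List.prod_le_sum_div_length_pow (ws.map (· + 1))
    (by simpa [← List.length_eq_zero_iff, hlen] using (by omega : k' ≠ 0))
  have hsum : (ws.map (· + 1)).sum = ws.sum + k' := by
    rw [List.sum_map_add]
    simp [hlen]
  rw [List.length_map, hlen, hsum] at hamgm
  have hX : (w : ℝ) ^ ((k : ℝ) / (k' : ℝ)) ≤ ((ws.sum + k' : ℕ) : ℝ) / k' := by
    refine le_of_pow_le_pow_left₀ (n := k') (by omega) (by positivity) ?_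
    rw [hXpow]
    exact le_trans (by exact_mod_cast hpieces) hamgm
  rw [le_div_iff₀ hk'pos] at hX
  rw [Nat.cast_add] at hX
  nlinarith
end

section
/- For any vectors b¹,…,bᵐ ∈ ℝⁿ, the support function γ of the zonotope Z(b¹,…,bᵐ), given by γ(r) = max_{x ∈ Z(b¹,…,bᵐ)} ⟨r,x⟩, can be represented by a ReLU DNN with one hidden layer (depth 2) of width 2m. -/
open scoped BigOperators

/-- Pairing with a point of the zonotope, expanded along the generators. -/
lemma sum_mul_sum_smul {n m : ℕ} (b : Fin m → Fin n → ℝ) (lam : Fin m → ℝ) (r : Fin n → ℝ) :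
    ∑ j, r j * (∑ i, lam i • b i) j = ∑ i, lam i * ∑ j, b i j * r j := by
  simp only [Finset.sum_apply, Pi.smul_apply, smul_eq_mul, Finset.mul_sum]
  rw [Finset.sum_comm]
  exact Finset.sum_congr rfl fun i _ => Finset.sum_congr rfl fun j _ => by ring

/-- The support function of a zonotope is the sum of the absolute values of the pairings with
its generators. -/
lemma isGreatest_image_zono {n m : ℕ} (b : Fin m → Fin n → ℝ) (r : Fin n → ℝ) :
    IsGreatest ((fun x => ∑ j, r j * x j) '' Zono b) (∑ i, |∑ j, b i j * r j|) := by
  constructor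
  · refine ⟨∑ i, (SignType.sign (∑ j, b i j * r j) : ℝ) • b i,
      ⟨fun i => SignType.sign (∑ j, b i j * r j), fun i => ?_, rfl⟩, ?_⟩
    · dsimp only
      cases SignType.sign (∑ j, b i j * r j) <;> simp
    · refine (sum_mul_sum_smul b _ r).trans (Finset.sum_congr rfl fun i _ => ?_)
      exact sign_mul_self _
  · rintro _ ⟨_, ⟨lam, hlam, rfl⟩, rfl⟩
    refine (sum_mul_sum_smul b lam r).trans_le (Finset.sum_le_sum fun i _ => ?_)
    calc lam i * ∑ j, b i j * r j ≤ |lam i| * |∑ j, b i j * r j| := by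
          rw [← abs_mul]; exact le_abs_self _
      _ ≤ |∑ j, b i j * r j| := mul_le_of_le_one_left (abs_nonneg _) (hlam i)

/-- A sum of absolute values of `m` linear forms is computed by one hidden layer of width
`2 * m`. -/
lemma representsR_sum_abs {n m : ℕ} (b : Fin m → Fin n → ℝ) :
    RepresentsR [2 * m] fun r : Fin n → ℝ => ∑ i, |∑ j, b i j * r j| := by
  let e : Fin (2 * m) ≃ Fin 2 × Fin m := finProdFinEquiv.symm
  let A : Matrix (Fin (2 * m)) (Fin n) ℝ :=
    fun k j => (if (e k).1 = 0 then 1 else -1) * b (e k).2 j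
  refine ⟨fun x => A.mulVec x + 0, fun y => Matrix.mulVec (fun _ _ => 1) y,
    ⟨A, 0, fun _ => rfl⟩, ⟨fun _ _ => 1, fun _ => rfl⟩, fun x => ?_⟩
  ext
  simp only [Matrix.mulVec, dotProduct, one_mul, reluVec, add_zero, A, mul_assoc,
    ← Finset.mul_sum]
  rw [Equiv.sum_comp e fun p => max ((if p.1 = 0 then 1 else -1) * ∑ j, b p.2 j * x j) 0,
    Fintype.sum_prod_type, Fin.sum_univ_two, ← Finset.sum_add_distrib]
  refine Finset.sum_congr rfl fun i _ => ?_
  simp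

/-- The support function of the zonotope `Z(b¹,…,bᵐ)` is representable by a ReLU
DNN with one hidden layer of width `2m`. -/
theorem stmt10 (n m : ℕ) (b : Fin m → Fin n → ℝ) (γ : (Fin n → ℝ) → ℝ)
    (hγ : ∀ r, IsGreatest ((fun x => ∑ j, r j * x j) '' Zono b) (γ r)) :
    RepresentsR [2 * m] γ := by
  have hγ_eq : γ = fun r => ∑ i, |∑ j, b i j * r j| :=
    funext fun r => (hγ r).unique (isGreatest_image_zono b r)
  exact hγ_eq ▸ representsR_sum_abs b
end

section
/- Let t : ℝ → ℝ be the tent function t(z) = min{z, 2−z}. For every affine function g(z) = cz + d with c, d ∈ ℝ, one has ∫₀² |t(z) − g(z)| dz ≥ 1/2. -/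
open scoped BigOperators

/-- The integral of a continuous function that dominates an affine function on `[a, b]`
is at least the integral of that affine function. -/
theorem integral_affine_le {f : ℝ → ℝ} (hf : Continuous f) {a b p q : ℝ} (hab : a ≤ b)
    (h : ∀ z ∈ Set.Icc a b, p * z + q ≤ f z) :
    p * ((b ^ 2 - a ^ 2) / 2) + q * (b - a) ≤ ∫ z in a..b, f z := by
  have hint : ∫ z in a..b, (p * z + q) = p * ((b ^ 2 - a ^ 2) / 2) + q * (b - a) := by
    rw [intervalIntegral.integral_add
      (Continuous.intervalIntegrable (by fun_prop) _ _)
      (Continuous.intervalIntegrable (by fun_prop) _ _),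
      intervalIntegral.integral_const_mul, integral_id, intervalIntegral.integral_const,
      smul_eq_mul]
    ring
  rw [← hint]
  exact intervalIntegral.integral_mono_on hab
    (Continuous.intervalIntegrable (by fun_prop) _ _) (hf.intervalIntegrable _ _) h

/-- The tent function `t(z) = min{z, 2−z}` satisfies
`∫₀² |t(z) − (cz+d)| dz ≥ 1/2` for every affine `cz + d`. -/
theorem stmt13 (c d : ℝ) :
    (1/2 : ℝ) ≤ ∫ z in (0:ℝ)..2, |min z (2 - z) - (c * z + d)| := by
  have hf : Continuous fun z : ℝ => |min z (2 - z) - (c * z + d)| := by fun_prop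
  have hi (a b : ℝ) := hf.intervalIntegrable (μ := MeasureTheory.volume) a b
  rw [← intervalIntegral.integral_add_adjacent_intervals (hi 0 1) (hi 1 2),
    ← intervalIntegral.integral_add_adjacent_intervals (hi 0 (1 / 2)) (hi (1 / 2) 1),
    ← intervalIntegral.integral_add_adjacent_intervals (hi 1 (3 / 2)) (hi (3 / 2) 2)]
  have h₁ := integral_affine_le hf (a := 0) (b := 1 / 2) (p := c - 1) (q := d) (by norm_num) (by
    rintro z ⟨_, hz⟩
    rw [min_eq_left (by linarith)]
    linarith [neg_abs_le (z - (c * z + d))])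
  have h₂ := integral_affine_le hf (a := 1 / 2) (b := 1) (p := 1 - c) (q := -d) (by norm_num) (by
    rintro z ⟨_, hz⟩
    rw [min_eq_left (by linarith)]
    linarith [le_abs_self (z - (c * z + d))])
  have h₃ := integral_affine_le hf (a := 1) (b := 3 / 2) (p := -1 - c) (q := 2 - d)
    (by norm_num) (by
      rintro z ⟨hz, _⟩
      rw [min_eq_right (by linarith)]
      linarith [le_abs_self (2 - z - (c * z + d))])
  have h₄ := integral_affine_le hf (a := 3 / 2) (b := 2) (p := c + 1) (q := d - 2)
    (by norm_num) (by
      rintro z ⟨hz, _⟩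
      rw [min_eq_right (by linarith)]
      linarith [neg_abs_le (2 - z - (c * z + d))])
  linarith
end

section
/- Let q ≥ 2 be a natural number and let s_q : [0,1] → ℝ be the sawtooth function that is affine on each interval [j/q, (j+1)/q] for j = 0,…,q−1 with s_q(j/q) = 0 for even j and s_q(j/q) = 1 for odd j (and s_q(1) accordingly). Then for every continuous piecewise linear function g : ℝ → ℝ with at most p pieces, ∫₀¹ |s_q(x) − g(x)| dx ≥ (⌊q/2⌋ − (p−1)) · (1/(2q)); in particular ∫₀¹ |s_q(x) − g(x)| dx ≥ 1/4 − (2p−1)/(4q). -/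
open scoped BigOperators

/-- Every point of `ℝ` lies in one of the closed pieces cut out by a monotone family of breakpoints. -/
theorem exists_piece_mem {m : ℕ} {b : Fin m → ℝ} (hb : Monotone b) (x : ℝ) :
    ∃ i : Fin (m + 1), (∀ j : Fin m, (j : ℕ) < (i : ℕ) → b j ≤ x) ∧
      ∀ j : Fin m, (i : ℕ) ≤ (j : ℕ) → x ≤ b j := by
  classical
  have hex : ∃ n : ℕ, ∀ j : Fin m, n ≤ (j : ℕ) → x ≤ b j :=
    ⟨m, fun j hj => absurd j.isLt (by omega)⟩
  have hle : Nat.find hex ≤ m :=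
    Nat.find_min' hex fun j hj => absurd j.isLt (by omega)
  refine ⟨⟨Nat.find hex, by omega⟩, fun j hj => ?_, Nat.find_spec hex⟩
  have hmin := Nat.find_min hex hj
  push Not at hmin
  obtain ⟨j', hjj', hlt⟩ := hmin
  exact (hb (Fin.le_def.mpr hjj')).trans hlt.le

theorem RealizesPieces.continuous {m : ℕ} {b : Fin m → ℝ} {sl ic : Fin (m + 1) → ℝ} {g : ℝ → ℝ}
    (h : RealizesPieces m b sl ic g) : Continuous g := by
  let C : Fin (m + 1) → Set ℝ := fun i =>
    {x | (∀ j : Fin m, (j : ℕ) < (i : ℕ) → b j ≤ x) ∧ ∀ j : Fin m, (i : ℕ) ≤ (j : ℕ) → x ≤ b j}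
  refine (locallyFinite_of_finite C).continuous ?_ ?_ ?_
  · exact Set.eq_univ_of_forall fun x =>
      Set.mem_iUnion.mpr (exists_piece_mem h.1.monotone x)
  · intro i
    simp only [C, Set.ofPred_and, Set.ofPred_forall]
    exact (isClosed_iInter fun j => isClosed_iInter fun _ => isClosed_le continuous_const
      continuous_id).inter (isClosed_iInter fun j => isClosed_iInter fun _ =>
        isClosed_le continuous_id continuous_const)
  · intro i
    have hcont : ContinuousOn (fun x => sl i * x + ic i) (C i) := by fun_prop
    exact hcont.congr fun x hx => h.2 i x hx.1 hx.2

/-- A piecewise linear function is affine on a closed interval with no breakpoint inside. -/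
theorem RealizesPieces.affine_on_Icc {m : ℕ} {b : Fin m → ℝ} {sl ic : Fin (m + 1) → ℝ}
    {g : ℝ → ℝ} (h : RealizesPieces m b sl ic g) {u v : ℝ} (huv : u < v)
    (hb : ∀ j, b j ∉ Set.Ioo u v) : ∃ α β : ℝ, ∀ x ∈ Set.Icc u v, g x = α * x + β := by
  obtain ⟨i, hi₁, hi₂⟩ := exists_piece_mem h.1.monotone ((u + v) / 2)
  refine ⟨sl i, ic i, fun x hx => h.2 i x (fun j hj => ?_) fun j hj => ?_⟩
  · have hj' := hi₁ j hj
    by_contra! hlt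
    exact hb j ⟨hx.1.trans_lt hlt, by linarith⟩
  · have hj' := hi₂ j hj
    by_contra! hlt
    exact hb j ⟨by linarith, hlt.trans_le hx.2⟩

theorem affine_integral_le {F : ℝ → ℝ} {u v c d : ℝ} (huv : u ≤ v)
    (hF : IntervalIntegrable F MeasureTheory.volume u v)
    (hle : ∀ x ∈ Set.Icc u v, c * x + d ≤ F x) :
    c * ((v ^ 2 - u ^ 2) / 2) + d * (v - u) ≤ ∫ x in u..v, F x := by
  have hint : ∫ x in u..v, (c * x + d) = c * ((v ^ 2 - u ^ 2) / 2) + d * (v - u) := by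
    rw [intervalIntegral.integral_add (by apply Continuous.intervalIntegrable; fun_prop)
      (by simp), intervalIntegral.integral_const_mul, integral_id,
      intervalIntegral.integral_const, smul_eq_mul]
    ring
  rw [← hint]
  exact intervalIntegral.integral_mono_on huv
    (by apply Continuous.intervalIntegrable; fun_prop) hF hle

/-- The `L¹` distance from a tent of height `1` and base `2 / r` to an affine function. -/
theorem tent_sub_affine_integral_le {s g : ℝ → ℝ} {r a α β : ℝ} (hr : 0 < r)
    (hup : ∀ x ∈ Set.Icc a (a + 1 / r), s x = r * (x - a))
    (hdown : ∀ x ∈ Set.Icc (a + 1 / r) (a + 2 / r), s x = 2 - r * (x - a))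
    (hg : ∀ x ∈ Set.Icc a (a + 2 / r), g x = α * x + β)
    (hint : IntervalIntegrable (fun x => |s x - g x|) MeasureTheory.volume a (a + 2 / r)) :
    1 / (2 * r) ≤ ∫ x in a..(a + 2 / r), |s x - g x| := by
  obtain ⟨h, rfl⟩ : ∃ h, r = 1 / h := ⟨1 / r, by simp⟩
  have hh : 0 < h := by simpa using hr
  simp only [one_div, div_inv_eq_mul] at *
  have hsub : ∀ u v, a ≤ u → u ≤ v → v ≤ a + 2 * h →
      IntervalIntegrable (fun x => |s x - g x|) MeasureTheory.volume u v := by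
    intro u v hu huv hv
    refine hint.mono_set ?_
    rw [Set.uIcc_of_le huv, Set.uIcc_of_le (by linarith)]
    exact Set.Icc_subset_Icc hu hv
  have I₁ := hsub a (a + h / 2) (by linarith) (by linarith) (by linarith)
  have I₂ := hsub (a + h / 2) (a + h) (by linarith) (by linarith) (by linarith)
  have I₃ := hsub (a + h) (a + 3 * h / 2) (by linarith) (by linarith) (by linarith)
  have I₄ := hsub (a + 3 * h / 2) (a + 2 * h) (by linarith) (by linarith) (by linarith)
  rw [← intervalIntegral.integral_add_adjacent_intervals (I₁.trans I₂ |>.trans I₃) I₄,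
    ← intervalIntegral.integral_add_adjacent_intervals (I₁.trans I₂) I₃,
    ← intervalIntegral.integral_add_adjacent_intervals I₁ I₂]
  have L₁ := affine_integral_le (c := α - h⁻¹) (d := β + h⁻¹ * a) (by linarith) I₁
    fun x hx => by
      rw [hup x ⟨by linarith [hx.1], by linarith [hx.2]⟩,
        hg x ⟨by linarith [hx.1], by linarith [hx.2]⟩]
      exact le_trans (le_of_eq (by ring)) (neg_le_abs _)
  have L₂ := affine_integral_le (c := h⁻¹ - α) (d := -(h⁻¹ * a) - β) (by linarith) I₂
    fun x hx => by
      rw [hup x ⟨by linarith [hx.1], by linarith [hx.2]⟩,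
        hg x ⟨by linarith [hx.1], by linarith [hx.2]⟩]
      exact le_trans (le_of_eq (by ring)) (le_abs_self _)
  have L₃ := affine_integral_le (c := -h⁻¹ - α) (d := 2 + h⁻¹ * a - β) (by linarith) I₃
    fun x hx => by
      rw [hdown x ⟨by linarith [hx.1], by linarith [hx.2]⟩,
        hg x ⟨by linarith [hx.1], by linarith [hx.2]⟩]
      exact le_trans (le_of_eq (by ring)) (le_abs_self _)
  have L₄ := affine_integral_le (c := α + h⁻¹) (d := β - 2 - h⁻¹ * a) (by linarith) I₄
    fun x hx => by
      rw [hdown x ⟨by linarith [hx.1], by linarith [hx.2]⟩,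
        hg x ⟨by linarith [hx.1], by linarith [hx.2]⟩]
      exact le_trans (le_of_eq (by ring)) (neg_le_abs _)
  refine le_trans (le_of_eq ?_) (add_le_add (add_le_add (add_le_add L₁ L₂) L₃) L₄)
  field_simp
  ring

/-- Among the first `n` intervals `(2k/r, (2k+2)/r)`, at most `m` contain one of `m` points. -/
theorem card_filter_exists_mem_Ioo_le {m n : ℕ} (b : Fin m → ℝ) {r : ℝ} (hr : 0 < r)
    [DecidablePred fun k : ℕ => ∃ j, b j ∈ Set.Ioo (2 * (k : ℝ) / r) (2 * (k : ℝ) / r + 2 / r)] :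
    ((Finset.range n).filter fun k : ℕ =>
      ∃ j, b j ∈ Set.Ioo (2 * (k : ℝ) / r) (2 * (k : ℝ) / r + 2 / r)).card ≤ m := by
  have hsub : ((Finset.range n).filter fun k : ℕ =>
      ∃ j, b j ∈ Set.Ioo (2 * (k : ℝ) / r) (2 * (k : ℝ) / r + 2 / r)) ⊆
      Finset.univ.image fun j => ⌊b j * r / 2⌋₊ := by
    intro k hk
    obtain ⟨-, j, hj₁, hj₂⟩ := Finset.mem_filter.mp hk
    refine Finset.mem_image.mpr ⟨j, Finset.mem_univ j, ?_⟩
    rw [div_lt_iff₀ hr] at hj₁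
    rw [← add_div, lt_div_iff₀ hr] at hj₂
    have hk0 : (0 : ℝ) ≤ k := Nat.cast_nonneg k
    exact (Nat.floor_eq_iff (by linarith)).mpr ⟨by linarith, by linarith⟩
  calc _ ≤ _ := Finset.card_le_card hsub
    _ ≤ (Finset.univ : Finset (Fin m)).card := Finset.card_image_le
    _ = m := by simp

/-- For the sawtooth `s_q` (affine on each `[j/q,(j+1)/q]`, `0` at even and `1`
at odd multiples of `1/q`) and any continuous piecewise linear `g` with at most `p` pieces,
`∫₀¹ |s_q − g| ≥ (⌊q/2⌋ − (p−1))/(2q) ≥ 1/4 − (2p−1)/(4q)`. -/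
theorem stmt14 (q : ℕ) (hq : 2 ≤ q) (s : ℝ → ℝ)
    (hs : ∀ j : ℕ, j < q → ∀ t ∈ Set.Icc (0:ℝ) 1,
      s ((1 - t) * ((j : ℝ) / q) + t * (((j : ℝ) + 1) / q))
        = (1 - t) * (if j % 2 = 0 then (0:ℝ) else 1)
          + t * (if (j + 1) % 2 = 0 then (0:ℝ) else 1))
    (p : ℕ) (g : ℝ → ℝ) (hg : PWLPiecesAtMost p g) :
    (((q / 2 : ℕ) : ℝ) - ((p : ℝ) - 1)) * (1 / (2 * (q : ℝ)))
        ≤ ∫ x in (0:ℝ)..1, |s x - g x| ∧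
    (1/4 : ℝ) - (2 * (p : ℝ) - 1) / (4 * (q : ℝ))
        ≤ ∫ x in (0:ℝ)..1, |s x - g x| := by
  have hq0 : (0 : ℝ) < q := by exact_mod_cast (by omega : 0 < q)
  obtain ⟨m, hmp, b, sl, ic, hR⟩ := hg
  have hs' : ∀ j : ℕ, j < q → ∀ x ∈ Set.Icc ((j : ℝ) / q) (((j : ℝ) + 1) / q),
      s x = if j % 2 = 0 then (q : ℝ) * x - j else j + 1 - q * x := by
    intro j hj x hx
    have h₁ := (div_le_iff₀ hq0).mp hx.1
    have h₂ := (le_div_iff₀ hq0).mp hx.2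
    have h := hs j hj (q * x - j) ⟨by linarith, by linarith⟩
    have hx' : (1 - ((q : ℝ) * x - j)) * ((j : ℝ) / q) + (q * x - j) * (((j : ℝ) + 1) / q) = x := by
      field_simp
      ring
    rw [hx'] at h
    rw [h]
    rcases Nat.mod_two_eq_zero_or_one j with hj2 | hj2
    · have : (j + 1) % 2 = 1 := by omega
      simp [hj2, this]
    · have : (j + 1) % 2 = 0 := by omega
      simp only [hj2, this, if_true, one_ne_zero, if_false]
      ring
  have hint : IntervalIntegrable (fun x => |s x - g x|) MeasureTheory.volume 0 1 := by
    have h := IntervalIntegrable.trans_iterate (f := fun x => |s x - g x|)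
      (μ := MeasureTheory.volume) (a := fun j : ℕ => (j : ℝ) / q) (n := q) fun j hj => by
        have hle : (j : ℝ) / q ≤ ((j : ℝ) + 1) / q := by gcongr; linarith
        have hsc : ContinuousOn s (Set.Icc ((j : ℝ) / q) (((j : ℝ) + 1) / q)) := by
          refine ContinuousOn.congr ?_ (hs' j hj)
          split_ifs <;> fun_prop
        refine ContinuousOn.intervalIntegrable ?_
        rw [Nat.cast_add, Nat.cast_one, Set.uIcc_of_le hle]
        exact (hsc.sub hR.continuous.continuousOn).abs
    simpa [hq0.ne'] using h
  have hhalf : 2 * ((q / 2 : ℕ) : ℝ) ≤ q := by exact_mod_cast (by omega : 2 * (q / 2) ≤ q)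
  have hhalf' : (q : ℝ) ≤ 2 * ((q / 2 : ℕ) : ℝ) + 1 := by
    exact_mod_cast (by omega : q ≤ 2 * (q / 2) + 1)
  have hend : ∀ k ≤ q / 2, 2 * (k : ℝ) / q ≤ 1 := fun k hk => by
    rw [div_le_one hq0]
    have : (k : ℝ) ≤ ((q / 2 : ℕ) : ℝ) := by exact_mod_cast hk
    linarith
  have hsucc : ∀ k : ℕ, 2 * ((k + 1 : ℕ) : ℝ) / q = 2 * (k : ℝ) / q + 2 / q := fun k => by
    push_cast
    ring
  have hperiod : ∀ k < q / 2, IntervalIntegrable (fun x => |s x - g x|) MeasureTheory.volume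
      (2 * (k : ℝ) / q) (2 * ((k + 1 : ℕ) : ℝ) / q) := fun k hk => by
    have hle : 2 * (k : ℝ) / q ≤ 2 * ((k + 1 : ℕ) : ℝ) / q := by
      rw [hsucc]
      linarith [div_pos two_pos hq0]
    refine hint.mono_set ?_
    rw [Set.uIcc_of_le hle, Set.uIcc_of_le zero_le_one]
    exact Set.Icc_subset_Icc (by positivity) (hend (k + 1) hk)
  have hmain : (((q / 2 : ℕ) : ℝ) - ((p : ℝ) - 1)) * (1 / (2 * (q : ℝ)))
      ≤ ∫ x in (0:ℝ)..1, |s x - g x| := by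
    classical
    let bad : ℕ → Prop := fun k =>
      ∃ j, b j ∈ Set.Ioo (2 * (k : ℝ) / q) (2 * (k : ℝ) / q + 2 / q)
    have hcard : ((Finset.range (q / 2)).filter bad).card ≤ m :=
      card_filter_exists_mem_Ioo_le b hq0
    have hgood : ((q / 2 : ℕ) : ℝ) - ((p : ℝ) - 1)
        ≤ (((Finset.range (q / 2)).filter fun k => ¬ bad k).card : ℝ) := by
      have h := Finset.card_filter_add_card_filter_not (s := Finset.range (q / 2)) bad
      rw [Finset.card_range] at h
      have h' : q / 2 + 1 ≤ ((Finset.range (q / 2)).filter fun k => ¬ bad k).card + p := by omega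
      have h'' : ((q / 2 : ℕ) : ℝ) + 1
          ≤ (((Finset.range (q / 2)).filter fun k => ¬ bad k).card : ℝ) + p := by
        exact_mod_cast h'
      linarith
    calc (((q / 2 : ℕ) : ℝ) - ((p : ℝ) - 1)) * (1 / (2 * (q : ℝ)))
        ≤ (((Finset.range (q / 2)).filter fun k => ¬ bad k).card : ℝ) * (1 / (2 * (q : ℝ))) := by
          gcongr
      _ = ∑ k ∈ (Finset.range (q / 2)).filter fun k => ¬ bad k, 1 / (2 * (q : ℝ)) := by
          rw [Finset.sum_const, nsmul_eq_mul]
      _ ≤ ∑ k ∈ (Finset.range (q / 2)).filter fun k => ¬ bad k,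
            ∫ x in (2 * (k : ℝ) / q)..(2 * ((k + 1 : ℕ) : ℝ) / q), |s x - g x| := by
          refine Finset.sum_le_sum fun k hk => ?_
          obtain ⟨hkr, hkb⟩ := Finset.mem_filter.mp hk
          have hk2 : k < q / 2 := Finset.mem_range.mp hkr
          obtain ⟨α, β, hαβ⟩ := hR.affine_on_Icc
            (lt_add_of_pos_right (2 * (k : ℝ) / q) (div_pos two_pos hq0)) (not_exists.mp hkb)
          have hI := hperiod k hk2
          rw [hsucc] at hI ⊢
          refine tent_sub_affine_integral_le hq0 (fun x hx => ?_) (fun x hx => ?_) hαβ hI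
          · rw [← add_div] at hx
            rw [hs' (2 * k) (by omega) x (by push_cast; exact hx), if_pos (by omega)]
            push_cast
            field_simp
          · rw [← add_div, ← add_div] at hx
            rw [hs' (2 * k + 1) (by omega) x (by push_cast; convert hx using 2; ring),
              if_neg (by omega)]
            push_cast
            field_simp
            ring
      _ ≤ ∑ k ∈ Finset.range (q / 2),
            ∫ x in (2 * (k : ℝ) / q)..(2 * ((k + 1 : ℕ) : ℝ) / q), |s x - g x| := by
          refine Finset.sum_le_sum_of_subset_of_nonneg (Finset.filter_subset _ _) fun k _ _ => ?_
          refine intervalIntegral.integral_nonneg ?_ fun x _ => abs_nonneg _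
          rw [hsucc]
          linarith [div_pos two_pos hq0]
      _ = ∫ x in (0:ℝ)..(2 * ((q / 2 : ℕ) : ℝ) / q), |s x - g x| := by
          rw [intervalIntegral.sum_integral_adjacent_intervals
            (a := fun k : ℕ => 2 * (k : ℝ) / q) hperiod]
          simp
      _ ≤ ∫ x in (0:ℝ)..1, |s x - g x| :=
          intervalIntegral.integral_mono_interval le_rfl (by positivity) (hend _ le_rfl)
            (Filter.Eventually.of_forall fun x => abs_nonneg _) hint
  refine ⟨hmain, le_trans ?_ hmain⟩
  rw [div_sub_div _ _ four_ne_zero (by positivity), mul_one_div,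
    div_le_div_iff₀ (by positivity) (by positivity)]
  nlinarith [mul_nonneg (mul_nonneg hq0.le hq0.le) (sub_nonneg.mpr hhalf'),
    mul_nonneg hq0.le (sub_nonneg.mpr hhalf')]
end
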